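/- arXiv:2209.13709 — 5 statements merged into one kernel-verified Lean document; each statement's English description precedes it below -/
import Mathlib

section
/- Let V and Q be real Hilbert spaces, let a : V × V → ℝ be a bounded bilinear form which is coercive, i.e. there exists α > 0 with a(v,v) ≥ α‖v‖_V² for all v ∈ V, and let b : V × Q → ℝ be a bounded bilinear form satisfying the inf-sup condition: there exists β > 0 such that β‖q‖_Q ≤ sup_{v ∈ V, v ≠ 0} b(v,q)/‖v‖_V for every q ∈ Q. Then there exists a constant C > 0 such that for every pair (u,p) ∈ V × Q, sup over all nonzero (v,q) ∈ V × Q of 𝒜((u,p),(v,q)) / ‖(v,q)‖_{V×Q} is at least C‖(u,p)‖_{V×Q}. -/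
/-- Stability of the combined saddle-point bilinear form
`𝒜((u,p),(v,q)) = a(u,v) + b(v,p) + b(u,q)` under coercivity of `a` and the
inf-sup condition for `b`. -/
theorem stmt0
    {V Q : Type*} [NormedAddCommGroup V] [InnerProductSpace ℝ V] [CompleteSpace V]
    [NormedAddCommGroup Q] [InnerProductSpace ℝ Q] [CompleteSpace Q]
    (a : V → V → ℝ) (b : V → Q → ℝ)
    (ha : IsBoundedBilinearMap ℝ (fun p : V × V => a p.1 p.2))
    (hb : IsBoundedBilinearMap ℝ (fun p : V × Q => b p.1 p.2))
    (hcoer : ∃ α > 0, ∀ v : V, α * ‖v‖ ^ 2 ≤ a v v)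
    (hinfsup : ∃ β > 0, ∀ q : Q,
      β * ‖q‖ ≤ sSup {r : ℝ | ∃ v : V, v ≠ 0 ∧ r = b v q / ‖v‖}) :
    ∃ C > 0, ∀ (u : V) (p : Q),
      C * Real.sqrt (‖u‖ ^ 2 + ‖p‖ ^ 2) ≤
        sSup {r : ℝ | ∃ v : V, ∃ q : Q, (v, q) ≠ 0 ∧
          r = (a u v + b v p + b u q) / Real.sqrt (‖v‖ ^ 2 + ‖q‖ ^ 2)} := by
  obtain ⟨α, hα, hcoer⟩ := hcoer
  obtain ⟨β, hβ, hinfsup⟩ := hinfsup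
  obtain ⟨M, hM, haM⟩ := ha.bound
  obtain ⟨B, hB, hbB⟩ := hb.bound
  have ha0 : ∀ v, a 0 v = 0 := fun v => by simpa using ha.smul_left 0 0 v
  have hb0l : ∀ q, b 0 q = 0 := fun q => by simpa using hb.smul_left 0 0 q
  have hb0r : ∀ v, b v 0 = 0 := fun v => by simpa using hb.smul_right 0 v 0
  have hbneg : ∀ v q, b v (-q) = -b v q := fun v q => by simpa using hb.smul_right (-1) v q
  have ha_le : ∀ u v, |a u v| ≤ M * ‖u‖ * ‖v‖ := haM
  have hb_le : ∀ v q, b v q ≤ B * ‖v‖ * ‖q‖ := fun v q => (le_abs_self _).trans (hbB v q)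
  refine ⟨((1 + 2 * M ^ 2 / β ^ 2) / α + 2 / β ^ 2 + 1)⁻¹, by positivity, fun u p => ?_⟩
  set S := sSup {r : ℝ | ∃ v : V, ∃ q : Q, (v, q) ≠ 0 ∧
    r = (a u v + b v p + b u q) / Real.sqrt (‖v‖ ^ 2 + ‖q‖ ^ 2)} with hS
  have hS_bdd : BddAbove {r : ℝ | ∃ v : V, ∃ q : Q, (v, q) ≠ 0 ∧
      r = (a u v + b v p + b u q) / Real.sqrt (‖v‖ ^ 2 + ‖q‖ ^ 2)} := by
    refine ⟨M * ‖u‖ + B * ‖p‖ + B * ‖u‖, ?_⟩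
    rintro r ⟨v, q, -, rfl⟩
    refine div_le_of_le_mul₀ (Real.sqrt_nonneg _) (by positivity) ?_
    have hv : ‖v‖ ≤ Real.sqrt (‖v‖ ^ 2 + ‖q‖ ^ 2) :=
      Real.le_sqrt_of_sq_le (by linarith [sq_nonneg ‖q‖])
    have hq : ‖q‖ ≤ Real.sqrt (‖v‖ ^ 2 + ‖q‖ ^ 2) :=
      Real.le_sqrt_of_sq_le (by linarith [sq_nonneg ‖v‖])
    calc a u v + b v p + b u q
        ≤ M * ‖u‖ * ‖v‖ + B * ‖v‖ * ‖p‖ + B * ‖u‖ * ‖q‖ :=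
          add_le_add_three ((le_abs_self _).trans (ha_le u v)) (hb_le v p) (hb_le u q)
      _ = M * ‖u‖ * ‖v‖ + B * ‖p‖ * ‖v‖ + B * ‖u‖ * ‖q‖ := by ring
      _ ≤ M * ‖u‖ * Real.sqrt (‖v‖ ^ 2 + ‖q‖ ^ 2) + B * ‖p‖ * Real.sqrt (‖v‖ ^ 2 + ‖q‖ ^ 2)
          + B * ‖u‖ * Real.sqrt (‖v‖ ^ 2 + ‖q‖ ^ 2) := by gcongr
      _ = _ := by ring
  have htest : ∀ v q, (v, q) ≠ 0 →
      a u v + b v p + b u q ≤ S * Real.sqrt (‖v‖ ^ 2 + ‖q‖ ^ 2) := by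
    intro v q hvq
    have hpos : 0 < ‖v‖ ^ 2 + ‖q‖ ^ 2 := by
      by_cases hv : v = 0
      · have hq : q ≠ 0 := fun hq => hvq (by simp [hv, hq])
        have := norm_pos_iff.2 hq
        positivity
      · have := norm_pos_iff.2 hv
        positivity
    exact (div_le_iff₀ (Real.sqrt_pos.2 hpos)).1 (le_csSup hS_bdd ⟨v, q, hvq, rfl⟩)
  by_cases hup : (u, p) = 0
  · obtain ⟨rfl, rfl⟩ := Prod.mk_eq_zero.1 hup
    simp only [norm_zero, ne_eq, OfNat.ofNat_ne_zero, not_false_eq_true, zero_pow, add_zero,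
      Real.sqrt_zero, mul_zero]
    refine Real.sSup_nonneg ?_
    rintro r ⟨v, q, -, rfl⟩
    simp [ha0, hb0l, hb0r]
  set N := Real.sqrt (‖u‖ ^ 2 + ‖p‖ ^ 2) with hN
  have hN_sq : N ^ 2 = ‖u‖ ^ 2 + ‖p‖ ^ 2 := Real.sq_sqrt (by positivity)
  have hN_pos : 0 < N := by
    refine (Real.sqrt_nonneg _).lt_of_ne' fun h => hup ?_
    have h0 : ‖u‖ ^ 2 + ‖p‖ ^ 2 = 0 := by rw [← hN_sq, hN, h]; simp
    have hu : ‖u‖ ^ 2 = 0 := by nlinarith [sq_nonneg ‖u‖, sq_nonneg ‖p‖]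
    have hp : ‖p‖ ^ 2 = 0 := by nlinarith [sq_nonneg ‖u‖, sq_nonneg ‖p‖]
    simpa using And.intro hu hp
  have hu_le : α * ‖u‖ ^ 2 ≤ S * N := by
    have h := htest u (-p) (by simpa using hup)
    rw [hbneg, norm_neg, ← hN] at h
    linarith [hcoer u]
  have hS_nonneg : 0 ≤ S :=
    nonneg_of_mul_nonneg_left ((by positivity : 0 ≤ α * ‖u‖ ^ 2).trans hu_le) hN_pos
  have hp_le : β * ‖p‖ ≤ S + M * ‖u‖ := by
    refine (hinfsup p).trans (Real.sSup_le ?_ (by positivity))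
    rintro r ⟨v, hv, rfl⟩
    rw [div_le_iff₀ (norm_pos_iff.2 hv)]
    have h := htest v 0 (by simpa using hv)
    simp only [hb0r, norm_zero, ne_eq, OfNat.ofNat_ne_zero, not_false_eq_true, zero_pow,
      add_zero, Real.sqrt_sq (norm_nonneg v)] at h
    linarith [neg_le_of_abs_le (ha_le u v)]
  have hu_sq : ‖u‖ ^ 2 ≤ S * N / α := by
    rw [le_div_iff₀ hα]; linarith
  have hp_sq : ‖p‖ ^ 2 ≤ 2 * (S ^ 2 + M ^ 2 * ‖u‖ ^ 2) / β ^ 2 := by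
    rw [le_div_iff₀ (by positivity)]
    have h := pow_le_pow_left₀ (by positivity) hp_le 2
    linarith [sq_nonneg (S - M * ‖u‖)]
  have hN_le : N ^ 2 ≤ (1 + 2 * M ^ 2 / β ^ 2) / α * (S * N) + 2 / β ^ 2 * S ^ 2 :=
    calc N ^ 2 ≤ ‖u‖ ^ 2 + 2 * (S ^ 2 + M ^ 2 * ‖u‖ ^ 2) / β ^ 2 := by linarith
      _ = (1 + 2 * M ^ 2 / β ^ 2) * ‖u‖ ^ 2 + 2 / β ^ 2 * S ^ 2 := by ring
      _ ≤ (1 + 2 * M ^ 2 / β ^ 2) * (S * N / α) + 2 / β ^ 2 * S ^ 2 := by gcongr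
      _ = _ := by ring
  have hK : 0 < (1 + 2 * M ^ 2 / β ^ 2) / α := by positivity
  have hL : 0 < 2 / β ^ 2 := by positivity
  generalize (1 + 2 * M ^ 2 / β ^ 2) / α = K at *
  generalize 2 / β ^ 2 = L at *
  rw [inv_mul_le_iff₀ (by positivity)]
  by_contra! hlt
  have hSN : S ≤ N := by nlinarith [mul_nonneg (add_pos hK hL).le hS_nonneg]
  have hSS : L * S ^ 2 ≤ L * (S * N) := by
    rw [sq]; gcongr
  nlinarith [mul_lt_mul_of_pos_right hlt hN_pos, mul_nonneg hS_nonneg hN_pos.le]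
end

section
/- Let V be a finite-dimensional real inner product space with an orthonormal basis φ_1, …, φ_N, let Q be a finite-dimensional real vector space, let χ_1, …, χ_N ∈ Q, and let μ_1, …, μ_N be positive reals. Let T : V × Q → V × Q be a linear equivalence satisfying T(μ_j · (φ_j, χ_j)) = (φ_j, 0) for every j = 1, …, N. Given f ∈ V, define u⁰ = f and, for i ≥ 1, (uⁱ, pⁱ) = T⁻¹(uⁱ⁻¹, 0). Define the linear operator B : V → V by B v = Σ_{j=1}^N μ_j ⟨v, φ_j⟩ φ_j. Then uⁱ = Bⁱ f for every i ≥ 1; in particular {u¹, u², …, u^ℓ} = {B f, B² f, …, B^ℓ f} is a Krylov sequence of the operator B. -/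
open RealInnerProductSpace

/-- The velocity snapshots `uⁱ` generated by repeatedly applying `T⁻¹` form the
Krylov sequence of the operator `B v = Σ μ_j ⟨v, φ_j⟩ φ_j`. -/
theorem stmt1
    {V Q : Type*} [NormedAddCommGroup V] [InnerProductSpace ℝ V] [FiniteDimensional ℝ V]
    [AddCommGroup Q] [Module ℝ Q] [FiniteDimensional ℝ Q]
    {N : ℕ} (φ : Fin N → V) (χ : Fin N → Q) (μ : Fin N → ℝ)
    (hφ : Orthonormal ℝ φ) (hspan : Submodule.span ℝ (Set.range φ) = ⊤)
    (hμ : ∀ j, 0 < μ j)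
    (T : (V × Q) ≃ₗ[ℝ] (V × Q))
    (hT : ∀ j, T (μ j • (φ j, χ j)) = (φ j, 0))
    (f : V) (u : ℕ → V) (p : ℕ → Q)
    (hu0 : u 0 = f)
    (hup : ∀ i, 1 ≤ i → (u i, p i) = T.symm (u (i - 1), 0))
    (B : V → V) (hB : ∀ v, B v = ∑ j, (μ j * ⟪v, φ j⟫) • φ j) :
    ∀ i, 1 ≤ i → u i = B^[i] f := by
  have key (v : V) : (T.symm (v, 0)).1 = B v := by
    have hv : v = ∑ j, ⟪v, φ j⟫ • φ j := by
      have h := (OrthonormalBasis.mk hφ hspan.ge).sum_repr' v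
      simpa [real_inner_comm] using h.symm
    have hsum : T (∑ j, ⟪v, φ j⟫ • μ j • (φ j, χ j)) = (v, 0) := by
      rw [map_sum]
      simp only [map_smul T (_ : ℝ) (μ _ • (φ _, χ _)), hT]
      ext
      · simpa [Prod.fst_sum] using hv.symm
      · simp [Prod.snd_sum]
    rw [← hsum, T.symm_apply_apply, hB]
    simp [Prod.fst_sum, smul_smul, mul_comm]
  have iterate_eq (i : ℕ) : u i = B^[i] f := by
    induction i with
    | zero => exact hu0
    | succ i ih =>
      rw [Function.iterate_succ_apply', ← ih, ← key]
      exact congrArg Prod.fst (hup (i + 1) (Nat.le_add_left 1 i))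
  exact fun i _ => iterate_eq i
end

section
/- Let r ≥ 2 and let K ∈ ℝ^{r×r} be a real positive semidefinite Hankel matrix with eigenvalues λ_1(K) ≥ λ_2(K) ≥ … ≥ λ_r(K) ≥ 0 listed in decreasing order. Set ρ = exp(π² / (4 log(8⌊r/2⌋/π))). Then for every natural number k with 2k + 1 ≤ r, λ_{2k+1}(K) ≤ 16 ρ^{−2k+2} λ_1(K). -/
open Real

namespace HankelDecay

/-- The general term of the theta series with nome `q`. -/
noncomputable def thetaTerm (q : ℝ) (z : ℂ) (n : ℤ) : ℂ := (q : ℂ) ^ (n ^ 2) * z ^ n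

/-- The theta series `∑ q ^ (n ^ 2) * z ^ n` over the integers. -/
noncomputable def theta (q : ℝ) (z : ℂ) : ℂ := ∑' n : ℤ, thetaTerm q z n

lemma thetaTerm_exp (T : ℝ) (x : ℂ) (n : ℤ) :
    thetaTerm (Real.exp (-π * T)) (Complex.exp (2 * π * Complex.I * x)) n =
      jacobiTheta₂_term n x (T * Complex.I) := by
  unfold thetaTerm jacobiTheta₂_term
  rw [Complex.ofReal_exp, ← Complex.exp_int_mul, ← Complex.exp_int_mul, ← Complex.exp_add]
  congr 1
  push_cast
  linear_combination (n : ℂ) ^ 2 * π * T * (-1) * Complex.I_sq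

lemma theta_exp (T : ℝ) (x : ℂ) :
    theta (Real.exp (-π * T)) (Complex.exp (2 * π * Complex.I * x)) =
      jacobiTheta₂ x (T * Complex.I) :=
  tsum_congr fun n => thetaTerm_exp T x n

lemma summable_thetaTerm {q : ℝ} (hq0 : 0 < q) (hq1 : q < 1) {z : ℂ} (hz : z ≠ 0) :
    Summable (thetaTerm q z) := by
  have hpi := Real.pi_pos
  have hT : 0 < -Real.log q / π := div_pos (neg_pos.2 (Real.log_neg hq0 hq1)) hpi
  have h1 : Real.exp (-π * (-Real.log q / π)) = q := by
    rw [show -π * (-Real.log q / π) = Real.log q by field_simp, Real.exp_log hq0]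
  have h2 : Complex.exp (2 * π * Complex.I * (Complex.log z / (2 * π * Complex.I))) = z := by
    rw [mul_div_cancel₀ _ Complex.two_pi_I_ne_zero, Complex.exp_log hz]
  have := (summable_jacobiTheta₂_term_iff (Complex.log z / (2 * π * Complex.I))
    ((-Real.log q / π : ℝ) * Complex.I)).2 (by simpa using hT)
  refine this.congr fun n => ?_
  rw [← thetaTerm_exp, h1, h2]

lemma thetaTerm_mul_thetaTerm {q : ℝ} (z w : ℂ) (m n : ℤ) (hq : q ≠ 0) :
    thetaTerm q z m * thetaTerm q w n = (q : ℂ) ^ (m ^ 2 + n ^ 2) * z ^ m * w ^ n := by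
  unfold thetaTerm
  rw [zpow_add₀ (by exact_mod_cast hq)]
  ring

lemma theta_mul_theta {q : ℝ} (hq0 : 0 < q) (hq1 : q < 1) {z w : ℂ} (hz : z ≠ 0) (hw : w ≠ 0) :
    HasSum (fun x : ℤ × ℤ => (q : ℂ) ^ (x.1 ^ 2 + x.2 ^ 2) * z ^ x.1 * w ^ x.2)
      (theta q z * theta q w) := by
  have hs := summable_thetaTerm hq0 hq1 hz
  have ht := summable_thetaTerm hq0 hq1 hw
  have h := (hs.hasSum.mul ht.hasSum (summable_mul_of_summable_norm hs.norm ht.norm))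
  simp only [thetaTerm_mul_thetaTerm _ _ _ _ hq0.ne'] at h
  exact h

lemma neg_zpow_eq (z : ℂ) (n : ℤ) : (-z) ^ n = (-1) ^ n * z ^ n := by
  rw [neg_eq_neg_one_mul, mul_zpow]

lemma theta_mul_sub {q : ℝ} (hq0 : 0 < q) (hq1 : q < 1) {z w : ℂ} (hz : z ≠ 0) (hw : w ≠ 0) :
    theta q z * theta q (-w) - theta q (-z) * theta q w =
      2 * q * z * (theta (q ^ 2) (-((q : ℂ) ^ 2 * (z * w))) *
        theta (q ^ 2) (-((q : ℂ) ^ 2 * (z / w)))) := by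
  have hqc : (q : ℂ) ≠ 0 := by exact_mod_cast hq0.ne'
  have hq2 : q ^ 2 < 1 := by nlinarith
  have h1 := (theta_mul_theta hq0 hq1 hz (neg_ne_zero.2 hw)).sub
    (theta_mul_theta hq0 hq1 (neg_ne_zero.2 hz) hw)
  have h2 := (theta_mul_theta (pow_pos hq0 2) hq2
    (z := -((q : ℂ) ^ 2 * (z * w))) (w := -((q : ℂ) ^ 2 * (z / w)))
    (by simp [hz, hw, hqc]) (by simp [hz, hw, hqc])).mul_left (2 * q * z)
  let φ : ℤ × ℤ → ℤ × ℤ := fun x => (x.1 + x.2 + 1, x.1 - x.2)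
  have hφ : Function.Injective φ := by
    rintro ⟨a, b⟩ ⟨c, d⟩ h
    simp only [φ, Prod.mk.injEq] at h ⊢
    omega
  refine ((hφ.hasSum_iff ?_).2 h1).unique ?_
  · rintro ⟨m, n⟩ hmn
    have hpar : Even (m - n) := by
      by_contra hodd
      rw [Int.not_even_iff_odd] at hodd
      obtain ⟨r, hr⟩ := hodd
      exact hmn ⟨(r + n, r), by simp only [φ, Prod.mk.injEq]; omega⟩
    have : (-1 : ℂ) ^ m = (-1) ^ n := by
      obtain ⟨r, hr⟩ := hpar
      rw [show m = n + 2 * r by omega, zpow_add₀ (by simp), zpow_mul]; simp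
    rw [neg_zpow_eq z, neg_zpow_eq w, this]
    ring
  · refine (congrArg (HasSum · _) (funext ?_)).mpr h2
    rintro ⟨a, b⟩
    have hsign : (-1 : ℂ) ^ (a - b) = (-1) ^ (a + b) := by
      rw [show a + b = (a - b) + 2 * b by ring, zpow_add₀ (by simp), zpow_mul]; simp
    simp only [φ, Function.comp]
    rw [neg_zpow_eq z, neg_zpow_eq w, neg_zpow_eq (_ * _), neg_zpow_eq (_ * _), hsign,
      show a + b + 1 = (a + b) + 1 by ring, zpow_add₀ (by simp : (-1 : ℂ) ≠ 0) (a + b) 1,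
      zpow_sub₀ hw, zpow_add₀ hz (a + b) 1, zpow_add₀ hz a b, mul_zpow, mul_zpow, mul_zpow,
      div_zpow, zpow_add₀ (by simp : (-1 : ℂ) ≠ 0) a b,
      show (a + b + 1) ^ 2 + (a - b) ^ 2 = 1 + 2 * a + 2 * b + 2 * (a ^ 2 + b ^ 2) by ring,
      zpow_add₀ hqc, zpow_add₀ hqc, zpow_add₀ hqc, zpow_mul, zpow_mul, zpow_mul]
    push_cast
    simp only [zpow_ofNat]
    ring

lemma theta_mul_add {q : ℝ} (hq0 : 0 < q) (hq1 : q < 1) {z w : ℂ} (hz : z ≠ 0) (hw : w ≠ 0) :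
    theta q z * theta q (-w) + theta q (-z) * theta q w =
      2 * (theta (q ^ 2) (-(z * w)) * theta (q ^ 2) (-(z / w))) := by
  have hqc : (q : ℂ) ≠ 0 := by exact_mod_cast hq0.ne'
  have hq2 : q ^ 2 < 1 := by nlinarith
  have h1 := (theta_mul_theta hq0 hq1 hz (neg_ne_zero.2 hw)).add
    (theta_mul_theta hq0 hq1 (neg_ne_zero.2 hz) hw)
  have h2 := (theta_mul_theta (pow_pos hq0 2) hq2 (z := -(z * w)) (w := -(z / w))
    (by simp [hz, hw]) (by simp [hz, hw])).mul_left 2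
  let φ : ℤ × ℤ → ℤ × ℤ := fun x => (x.1 + x.2, x.1 - x.2)
  have hφ : Function.Injective φ := by
    rintro ⟨a, b⟩ ⟨c, d⟩ h
    simp only [φ, Prod.mk.injEq] at h ⊢
    omega
  refine ((hφ.hasSum_iff ?_).2 h1).unique ?_
  · rintro ⟨m, n⟩ hmn
    have hpar : Odd (m - n) := by
      by_contra heven
      rw [Int.not_odd_iff_even] at heven
      obtain ⟨r, hr⟩ := heven
      exact hmn ⟨(r + n, r), by simp only [φ, Prod.mk.injEq]; omega⟩
    have : (-1 : ℂ) ^ m = -(-1) ^ n := by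
      obtain ⟨r, hr⟩ := hpar
      rw [show m = n + 2 * r + 1 by omega, zpow_add₀ (by simp), zpow_add₀ (by simp), zpow_mul]
      simp
    rw [neg_zpow_eq z, neg_zpow_eq w, this]
    ring
  · refine (congrArg (HasSum · _) (funext ?_)).mpr h2
    rintro ⟨a, b⟩
    have hsign : (-1 : ℂ) ^ (a - b) = (-1) ^ (a + b) := by
      rw [show a + b = (a - b) + 2 * b by ring, zpow_add₀ (by simp), zpow_mul]; simp
    simp only [φ, Function.comp]
    rw [neg_zpow_eq z, neg_zpow_eq w, neg_zpow_eq (_ * _), neg_zpow_eq (_ / _), hsign,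
      zpow_sub₀ hw, zpow_add₀ hz a b, mul_zpow, div_zpow, zpow_add₀ (by simp : (-1 : ℂ) ≠ 0) a b,
      show (a + b) ^ 2 + (a - b) ^ 2 = 2 * (a ^ 2 + b ^ 2) by ring, zpow_mul]
    push_cast
    simp only [zpow_ofNat]
    ring

/-- The periodised Gaussian of variance proportional to `T`. -/
noncomputable def gaussSum (T x : ℝ) : ℝ := ∑' n : ℤ, Real.exp (-π * (x - n) ^ 2 / T)

lemma hasSum_gauss_complex {T : ℝ} (hT : 0 < T) (x : ℝ) :
    HasSum (fun n : ℤ => ((Real.exp (-π * (x - n) ^ 2 / T) : ℝ) : ℂ))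
      (((T ^ (1 / 2 : ℝ) : ℝ) : ℂ) * jacobiTheta₂ x (T * Complex.I)) := by
  have hTc : (T : ℂ) ≠ 0 := by exact_mod_cast hT.ne'
  have him : 0 < (-1 / (T * Complex.I)).im := by
    have : -1 / (T * Complex.I) = ((1 / T : ℝ) : ℂ) * Complex.I := by
      push_cast; field_simp; simp
    rw [this]; simpa using hT
  have hroot : ((T ^ (1 / 2 : ℝ) : ℝ) : ℂ) ≠ 0 := by
    exact_mod_cast (Real.rpow_pos_of_pos hT _).ne'
  have h := (hasSum_jacobiTheta₂_term (x / (T * Complex.I)) him).mul_left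
    (Complex.exp (-π * Complex.I * x ^ 2 / (T * Complex.I)))
  have hval : Complex.exp (-π * Complex.I * x ^ 2 / (T * Complex.I)) *
      jacobiTheta₂ (x / (T * Complex.I)) (-1 / (T * Complex.I)) =
      ((T ^ (1 / 2 : ℝ) : ℝ) : ℂ) * jacobiTheta₂ x (T * Complex.I) := by
    rw [jacobiTheta₂_functional_equation x (T * Complex.I)]
    have : (-Complex.I * (T * Complex.I)) ^ (1 / 2 : ℂ) = ((T ^ (1 / 2 : ℝ) : ℝ) : ℂ) := by
      rw [Complex.ofReal_cpow hT.le]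
      congr 1
      · linear_combination (-(T : ℂ)) * Complex.I_sq
      · push_cast; rfl
    rw [this]
    field_simp
  rw [hval] at h
  refine (congrArg (HasSum · _) (funext fun n => ?_)).mpr h
  unfold jacobiTheta₂_term
  rw [Complex.ofReal_exp, ← Complex.exp_add]
  congr 1
  push_cast
  field_simp
  ring

lemma summable_gauss {T : ℝ} (hT : 0 < T) (x : ℝ) :
    Summable fun n : ℤ => Real.exp (-π * (x - n) ^ 2 / T) :=
  Complex.summable_ofReal.1 (hasSum_gauss_complex hT x).summable

lemma ofReal_gaussSum {T : ℝ} (hT : 0 < T) (x : ℝ) :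
    (gaussSum T x : ℂ) = ((T ^ (1 / 2 : ℝ) : ℝ) : ℂ) * jacobiTheta₂ x (T * Complex.I) := by
  rw [← (hasSum_gauss_complex hT x).tsum_eq, gaussSum, Complex.ofReal_tsum]

lemma gaussSum_pos {T : ℝ} (hT : 0 < T) (x : ℝ) : 0 < gaussSum T x :=
  (summable_gauss hT x).tsum_pos (fun _ => (Real.exp_pos _).le) 0 (Real.exp_pos _)

lemma continuous_gaussSum {T : ℝ} (hT : 0 < T) : Continuous (gaussSum T) := by
  have h : gaussSum T = fun x : ℝ =>
      (((T ^ (1 / 2 : ℝ) : ℝ) : ℂ) * jacobiTheta₂ x (T * Complex.I)).re := by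
    ext x
    rw [← ofReal_gaussSum hT, Complex.ofReal_re]
  rw [h]
  have hc : Continuous fun x : ℝ => jacobiTheta₂ x (T * Complex.I) :=
    continuous_iff_continuousAt.2 fun x =>
      (differentiableAt_jacobiTheta₂_fst (x : ℂ) (τ := T * Complex.I)
        (by simpa using hT)).continuousAt.comp (f := fun x : ℝ => (x : ℂ))
        Complex.continuous_ofReal.continuousAt
  fun_prop

lemma gaussSum_add_one (T x : ℝ) : gaussSum T (x + 1) = gaussSum T x := by
  unfold gaussSum
  rw [← (Equiv.addRight (1 : ℤ)).tsum_eq]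
  refine tsum_congr fun n => ?_
  simp

lemma gaussSum_half_le {T : ℝ} (hT : 0 < T) :
    gaussSum T (1 / 2) ≤ 2 * Real.exp (-(π / (4 * T))) * gaussSum T 0 := by
  have hs0 := summable_gauss hT 0
  have hs1 := summable_gauss hT 1
  have h1 : gaussSum T 1 = gaussSum T 0 := by simpa using gaussSum_add_one T 0
  have hle : gaussSum T (1 / 2) ≤
      ∑' n : ℤ, Real.exp (-(π / (4 * T))) * (Real.exp (-π * (0 - n) ^ 2 / T) +
        Real.exp (-π * (1 - n) ^ 2 / T)) := by
    refine (summable_gauss hT _).tsum_le_tsum (fun n => ?_) ((hs0.add hs1).mul_left _)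
    have key : ∀ c : ℤ, c ^ 2 ≤ n * (n - 1) →
        Real.exp (-π * (1 / 2 - n) ^ 2 / T) ≤
          Real.exp (-(π / (4 * T))) * Real.exp (-π * (c : ℝ) ^ 2 / T) := by
      intro c hc
      have hcR : (c : ℝ) ^ 2 ≤ n * (n - 1) := by exact_mod_cast hc
      rw [← Real.exp_add]
      refine Real.exp_le_exp.2 ?_
      rw [show -(π / (4 * T)) + -π * (c : ℝ) ^ 2 / T = (-π * (1 / 4 + (c : ℝ) ^ 2)) / T by
        field_simp; ring]
      gcongr ?_ / T
      nlinarith [Real.pi_pos]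
    rcases le_or_gt n 0 with hn | hn
    · have := key (-n) (by nlinarith)
      push_cast at this
      rw [mul_add]
      rw [show (0 : ℝ) - n = -n by ring]
      have := (Real.exp_pos (-(π / (4 * T))))
      have := (Real.exp_pos (-π * (1 - n) ^ 2 / T))
      nlinarith
    · have := key (1 - n) (by nlinarith)
      push_cast at this
      rw [mul_add]
      have := (Real.exp_pos (-(π / (4 * T))))
      have := (Real.exp_pos (-π * (0 - n) ^ 2 / T))
      nlinarith
  rw [tsum_mul_left, hs0.tsum_add hs1] at hle
  change _ ≤ _ * (gaussSum T 0 + gaussSum T 1) at hle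
  rw [h1] at hle
  linarith

/-- Every point of `[1 / b, b]`, with `2 * b = exp (π / (4 * T))`, is a quotient of two values of
the periodised Gaussian half a period apart. -/
lemma exists_gaussSum_quotient {T : ℝ} (hT : 0 < T) {b t : ℝ}
    (hb : 0 < b) (hbT : 2 * b ≤ Real.exp (π / (4 * T))) (ht1 : 1 / b ≤ t) (ht2 : t ≤ b) :
    ∃ x : ℝ, t = gaussSum T x / gaussSum T (x + 1 / 2) := by
  have hpos := gaussSum_pos hT
  have h0 : b ≤ gaussSum T 0 / gaussSum T (1 / 2) := by
    rw [le_div_iff₀ (hpos _)]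
    have h := gaussSum_half_le hT
    rw [Real.exp_neg] at h
    have hE := Real.exp_pos (π / (4 * T))
    calc b * gaussSum T (1 / 2) ≤ b * (2 * (Real.exp (π / (4 * T)))⁻¹ * gaussSum T 0) := by gcongr
      _ = (2 * b / Real.exp (π / (4 * T))) * gaussSum T 0 := by ring
      _ ≤ 1 * gaussSum T 0 := by
        gcongr
        · exact (hpos 0).le
        · exact (div_le_one hE).2 hbT
      _ = _ := one_mul _
  have hcont : Continuous fun x => gaussSum T x / gaussSum T (x + 1 / 2) := by
    have := continuous_gaussSum hT
    exact this.div (by fun_prop) fun x => (hpos _).ne'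
  have h1 : gaussSum T (1 / 2) / gaussSum T (1 / 2 + 1 / 2) ≤ 1 / b := by
    rw [show (1 / 2 + 1 / 2 : ℝ) = 0 + 1 by norm_num, gaussSum_add_one,
      ← one_div_div (gaussSum T 0)]
    gcongr
  have := intermediate_value_Icc' (by norm_num : (0 : ℝ) ≤ 1 / 2) hcont.continuousOn
  obtain ⟨x, -, hx⟩ := this ⟨h1.trans ht1, ht2.trans (by simpa using h0)⟩
  exact ⟨x, hx.symm⟩

/-- The `q`-Pochhammer product `(t; t)_n`. -/
noncomputable def qPoch (t : ℝ) (n : ℕ) : ℝ := ∏ i ∈ Finset.range n, (1 - t ^ (i + 1))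

/-- The reciprocal of `(t; t)_n`, extended by zero to negative `n`. -/
noncomputable def invQPoch (t : ℝ) (n : ℤ) : ℝ := if 0 ≤ n then (qPoch t n.toNat)⁻¹ else 0

/-- The partial products of the triple product with nome `q`. -/
noncomputable def tripleProd (q : ℝ) (n : ℕ) (z : ℂ) : ℂ :=
  ∏ l ∈ Finset.range n, ((1 + z * q ^ (2 * l + 1)) * (1 + z⁻¹ * q ^ (2 * l + 1)))

lemma qPoch_pos {t : ℝ} (ht0 : 0 ≤ t) (ht1 : t < 1) (n : ℕ) : 0 < qPoch t n :=
  Finset.prod_pos fun _ _ => sub_pos.2 (pow_lt_one₀ ht0 ht1 (Nat.succ_ne_zero _))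

lemma qPoch_antitone {t : ℝ} (ht0 : 0 ≤ t) (ht1 : t < 1) : Antitone (qPoch t) := by
  refine antitone_nat_of_succ_le fun n => ?_
  rw [qPoch, Finset.prod_range_succ]
  exact mul_le_of_le_one_right (qPoch_pos ht0 ht1 n).le
    (sub_le_self _ (pow_nonneg ht0 _))

lemma exists_qPoch_lim {t : ℝ} (ht0 : 0 ≤ t) (ht1 : t < 1) :
    ∃ E : ℝ, 0 < E ∧ (∀ n, E ≤ qPoch t n) ∧ Filter.Tendsto (qPoch t) Filter.atTop (nhds E) := by
  have hs : Summable fun n : ℕ => -t ^ (n + 1) :=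
    ((summable_nat_add_iff 1).2 (summable_geometric_of_lt_one ht0 ht1)).neg
  have hprod := (Real.multipliable_one_add_of_summable hs).hasProd.tendsto_prod_nat
  have hne : ∏' n : ℕ, (1 + -t ^ (n + 1)) ≠ 0 :=
    tprod_one_add_ne_zero_of_summable
      (fun i => by have := pow_lt_one₀ ht0 ht1 i.add_one_ne_zero; linarith)
      hs.norm
  have hlim : Filter.Tendsto (qPoch t) Filter.atTop (nhds (∏' n : ℕ, (1 + -t ^ (n + 1)))) := by
    simp only [← sub_eq_add_neg] at hprod ⊢
    exact hprod
  refine ⟨_, lt_of_le_of_ne ?_ hne.symm, (qPoch_antitone ht0 ht1).le_of_tendsto hlim, hlim⟩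
  exact ge_of_tendsto' hlim fun n => (qPoch_pos ht0 ht1 n).le

lemma invQPoch_sub_one {t : ℝ} (ht0 : 0 ≤ t) (ht1 : t < 1) (n : ℤ) :
    invQPoch t (n - 1) = (1 - t ^ n) * invQPoch t n := by
  rcases lt_trichotomy n 0 with hn | rfl | hn
  · simp [invQPoch, not_le.2 hn, show ¬ (1 ≤ n) by omega]
  · simp [invQPoch]
  · obtain ⟨m, rfl⟩ : ∃ m : ℕ, n = (m + 1 : ℕ) := ⟨(n - 1).toNat, by omega⟩
    have h1 : ((m + 1 : ℕ) : ℤ) - 1 = m := by push_cast; ring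
    rw [h1]
    have hne := (qPoch_pos ht0 ht1 m).ne'
    have hne' : 1 - t ^ (m + 1) ≠ 0 := (sub_pos.2 (pow_lt_one₀ ht0 ht1 m.succ_ne_zero)).ne'
    have h2 : qPoch t (m + 1) = qPoch t m * (1 - t ^ (m + 1)) := Finset.prod_range_succ _ _
    simp only [invQPoch, Int.natCast_nonneg, if_true, Int.toNat_natCast, h2, zpow_natCast]
    field_simp

lemma qPoch_add_two (t : ℝ) (n : ℕ) :
    qPoch t (2 * (n + 1)) = qPoch t (2 * n) * (1 - t ^ (2 * n + 1)) * (1 - t ^ (2 * n + 2)) := by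
  rw [show 2 * (n + 1) = 2 * n + 1 + 1 by ring, qPoch, Finset.prod_range_succ,
    Finset.prod_range_succ]
  rfl

lemma coeff_rec {q : ℝ} (hq0 : 0 < q) (hq1 : q < 1) (n : ℕ) (i : ℤ) :
    qPoch (q ^ 2) (2 * (n + 1)) * invQPoch (q ^ 2) ((n + 1 : ℕ) - i) *
        invQPoch (q ^ 2) ((n + 1 : ℕ) + i) * q ^ (i ^ 2) =
      (1 + q ^ (4 * n + 2)) * (qPoch (q ^ 2) (2 * n) * invQPoch (q ^ 2) (n - i) *
        invQPoch (q ^ 2) (n + i) * q ^ (i ^ 2)) +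
      q ^ (2 * n + 1) * (qPoch (q ^ 2) (2 * n) * invQPoch (q ^ 2) (n - (i - 1)) *
        invQPoch (q ^ 2) (n + (i - 1)) * q ^ ((i - 1) ^ 2)) +
      q ^ (2 * n + 1) * (qPoch (q ^ 2) (2 * n) * invQPoch (q ^ 2) (n - (i + 1)) *
        invQPoch (q ^ 2) (n + (i + 1)) * q ^ ((i + 1) ^ 2)) := by
  have hq := hq0.ne'
  have ht0 : 0 ≤ q ^ 2 := by positivity
  have ht1 : q ^ 2 < 1 := by nlinarith
  have hrec := invQPoch_sub_one ht0 ht1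
  set t := q ^ 2 with ht
  have htne : t ≠ 0 := by positivity
  have e1 : invQPoch t (n - i) = (1 - t ^ ((n + 1 : ℕ) - i : ℤ)) * invQPoch t ((n + 1 : ℕ) - i) := by
    rw [← hrec]; congr 1; push_cast; ring
  have e2 : invQPoch t (n + i) = (1 - t ^ ((n + 1 : ℕ) + i : ℤ)) * invQPoch t ((n + 1 : ℕ) + i) := by
    rw [← hrec]; congr 1; push_cast; ring
  have e3 : invQPoch t (n - (i + 1)) = (1 - t ^ ((n + 1 : ℕ) - i : ℤ) / t) * invQPoch t (n - i) := by
    rw [div_eq_mul_inv, ← zpow_sub_one₀ htne, show ((n + 1 : ℕ) - i - 1 : ℤ) = n - i by push_cast; ring, ← hrec]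
    congr 1; ring
  have e4 : invQPoch t (n + (i - 1)) = (1 - t ^ ((n + 1 : ℕ) + i : ℤ) / t) * invQPoch t (n + i) := by
    rw [div_eq_mul_inv, ← zpow_sub_one₀ htne, show ((n + 1 : ℕ) + i - 1 : ℤ) = n + i by push_cast; ring, ← hrec]
    congr 1; ring
  have e5 : (n : ℤ) - (i - 1) = (n + 1 : ℕ) - i := by push_cast; ring
  have e6 : (n : ℤ) + (i + 1) = (n + 1 : ℕ) + i := by push_cast; ring
  have p1 : q ^ (2 * n + 1) * q ^ ((i - 1) ^ 2) = t ^ ((n + 1 : ℕ) - i : ℤ) * q ^ (i ^ 2) := by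
    rw [ht, ← zpow_natCast, ← zpow_natCast q 2, ← zpow_mul, ← zpow_add₀ hq, ← zpow_add₀ hq]
    congr 1; push_cast; ring
  have p2 : q ^ (2 * n + 1) * q ^ ((i + 1) ^ 2) = t ^ ((n + 1 : ℕ) + i : ℤ) * q ^ (i ^ 2) := by
    rw [ht, ← zpow_natCast, ← zpow_natCast q 2, ← zpow_mul, ← zpow_add₀ hq, ← zpow_add₀ hq]
    congr 1; push_cast; ring
  have p3 : t ^ (2 * n + 2) = t ^ ((n + 1 : ℕ) - i : ℤ) * t ^ ((n + 1 : ℕ) + i : ℤ) := by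
    rw [← zpow_natCast, ← zpow_add₀ htne]
    congr 1; push_cast; ring
  have p4 : t ^ (2 * n + 1) = t ^ ((n + 1 : ℕ) - i : ℤ) * t ^ ((n + 1 : ℕ) + i : ℤ) / t := by
    rw [← p3, pow_succ t (2 * n + 1)]; field_simp
  have p5 : q ^ (4 * n + 2) = t ^ (2 * n + 1) := by rw [ht, ← pow_mul]; ring_nf
  rw [e5, e6, e3, e4, e1, e2, qPoch_add_two, p5, p3, p4]
  generalize t ^ ((n + 1 : ℕ) - i : ℤ) = X at *
  generalize t ^ ((n + 1 : ℕ) + i : ℤ) = Y at *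
  generalize invQPoch t ((n + 1 : ℕ) - i) = A at *
  generalize invQPoch t ((n + 1 : ℕ) + i) = B at *
  generalize qPoch t (2 * n) = e at *
  linear_combination (-e * A * ((1 - Y / t) * ((1 - Y) * B))) * p1 -
    e * ((1 - X / t) * ((1 - X) * A)) * B * p2

/-- The finite form of the Jacobi triple product identity. -/
lemma hasSum_tripleProd {q : ℝ} (hq0 : 0 < q) (hq1 : q < 1) {z : ℂ} (hz : z ≠ 0) (n : ℕ) :
    HasSum (fun i : ℤ => ((qPoch (q ^ 2) (2 * n) * invQPoch (q ^ 2) (n - i) *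
      invQPoch (q ^ 2) (n + i) : ℝ) : ℂ) * thetaTerm q z i) (tripleProd q n z) := by
  induction n with
  | zero =>
    have : tripleProd q 0 z = ((qPoch (q ^ 2) (2 * 0) * invQPoch (q ^ 2) ((0 : ℕ) - 0) *
      invQPoch (q ^ 2) ((0 : ℕ) + 0) : ℝ) : ℂ) * thetaTerm q z 0 := by
      simp [tripleProd, qPoch, invQPoch, thetaTerm]
    rw [this]
    refine hasSum_single 0 fun i hi => ?_
    rcases lt_or_gt_of_ne hi with h | h
    · simp [invQPoch, not_le.2 h]
    · simp [invQPoch, not_le.2 h]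
  | succ n ih =>
    have hR := ((Equiv.subRight (1 : ℤ)).hasSum_iff.2 ih).mul_left ((q : ℂ) ^ (2 * n + 1) * z)
    have hL := ((Equiv.addRight (1 : ℤ)).hasSum_iff.2 ih).mul_left ((q : ℂ) ^ (2 * n + 1) * z⁻¹)
    have h := ((ih.mul_left (1 + (q : ℂ) ^ (4 * n + 2))).add hR).add hL
    have hval : tripleProd q (n + 1) z = (1 + (q : ℂ) ^ (4 * n + 2)) * tripleProd q n z +
        (q : ℂ) ^ (2 * n + 1) * z * tripleProd q n z +
        (q : ℂ) ^ (2 * n + 1) * z⁻¹ * tripleProd q n z := by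
      rw [tripleProd, Finset.prod_range_succ, ← tripleProd]
      rw [show 4 * n + 2 = (2 * n + 1) + (2 * n + 1) by ring, pow_add]
      field_simp
      ring
    rw [hval]
    refine (congrArg (HasSum · _) (funext fun i => ?_)).mpr h
    have hc := congrArg (fun x : ℝ => (x : ℂ) * z ^ i) (coeff_rec hq0 hq1 n i)
    simp only [Function.comp, Equiv.subRight_apply, Equiv.coe_addRight, thetaTerm,
      zpow_sub_one₀ hz, zpow_add_one₀ hz]
    push_cast at hc ⊢
    have hzz : z * z⁻¹ = 1 := mul_inv_cancel₀ hz
    linear_combination hc - z ^ i * q ^ (2 * n + 1) * qPoch (q ^ 2) (2 * n) *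
      (invQPoch (q ^ 2) (n - (i - 1)) * invQPoch (q ^ 2) (n + (i - 1)) * q ^ (i - 1) ^ 2 +
        invQPoch (q ^ 2) (n - (i + 1)) * invQPoch (q ^ 2) (n + (i + 1)) * q ^ (i + 1) ^ 2) * hzz

/-- The Jacobi triple product, with an unspecified constant. -/
lemma exists_tendsto_tripleProd {q : ℝ} (hq0 : 0 < q) (hq1 : q < 1) :
    ∃ C : ℝ, ∀ z : ℂ, z ≠ 0 → Filter.Tendsto (fun n => (C : ℂ) * tripleProd q n z) Filter.atTop
      (nhds (theta q z)) := by
  have ht0 : 0 ≤ q ^ 2 := by positivity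
  have ht1 : q ^ 2 < 1 := by nlinarith
  obtain ⟨E, hE, hle, hlim⟩ := exists_qPoch_lim ht0 ht1
  refine ⟨E, fun z hz => ?_⟩
  have hs := summable_thetaTerm hq0 hq1 hz
  have hinv : ∀ i, |invQPoch (q ^ 2) i| ≤ E⁻¹ := by
    intro i
    unfold invQPoch
    split_ifs
    · rw [abs_of_pos (inv_pos.2 (qPoch_pos ht0 ht1 _))]
      exact inv_anti₀ hE (hle _)
    · simpa using hE.le
  have hinvlim : ∀ f : ℕ → ℤ, Filter.Tendsto f Filter.atTop Filter.atTop →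
      Filter.Tendsto (fun n => invQPoch (q ^ 2) (f n)) Filter.atTop (nhds E⁻¹) := by
    intro f hf
    have hnat : Filter.Tendsto (fun n => (f n).toNat) Filter.atTop Filter.atTop :=
      Filter.tendsto_atTop.2 fun b => by
        filter_upwards [hf.eventually_ge_atTop (b : ℤ)] with n hn
        omega
    refine ((hlim.comp hnat).inv₀ hE.ne').congr' ?_
    filter_upwards [hf.eventually_ge_atTop 0] with n hn
    simp [invQPoch, hn]
  have hcast : Filter.Tendsto (fun n : ℕ => (n : ℤ)) Filter.atTop Filter.atTop :=
    tendsto_natCast_atTop_atTop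
  have hq2 : Filter.Tendsto (fun n : ℕ => qPoch (q ^ 2) (2 * n)) Filter.atTop (nhds E) :=
    hlim.comp (Filter.tendsto_id.const_mul_atTop' (by norm_num))
  have key := tendsto_tsum_of_dominated_convergence (𝓕 := Filter.atTop)
    (f := fun (n : ℕ) (i : ℤ) => (E : ℂ) * (((qPoch (q ^ 2) (2 * n) * invQPoch (q ^ 2) (n - i) *
      invQPoch (q ^ 2) (n + i) : ℝ) : ℂ) * thetaTerm q z i)) (g := thetaTerm q z)
    (bound := fun i => E * (1 * E⁻¹ * E⁻¹ * ‖thetaTerm q z i‖))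
    ((hs.norm.mul_left _).mul_left _) ?_ ?_
  · refine key.congr fun n => ?_
    rw [tsum_mul_left, (hasSum_tripleProd hq0 hq1 hz n).tsum_eq]
  · intro i
    have h1 := (hq2.mul (hinvlim (fun n => n - i) (Filter.tendsto_atTop_add_const_right _ _ hcast))).mul
      (hinvlim (fun n => n + i) (Filter.tendsto_atTop_add_const_right _ _ hcast))
    have h2 := (((Complex.continuous_ofReal.tendsto _).comp h1).mul_const (thetaTerm q z i)).const_mul (E : ℂ)
    have hv : (E : ℂ) * (((E * E⁻¹ * E⁻¹ : ℝ) : ℂ) * thetaTerm q z i) = thetaTerm q z i := by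
      have : (E : ℂ) ≠ 0 := by exact_mod_cast hE.ne'
      push_cast; field_simp
    rw [hv] at h2
    exact h2
  · refine Filter.Eventually.of_forall fun n i => ?_
    rw [norm_mul, norm_mul, Complex.norm_real, Complex.norm_real, Real.norm_of_nonneg hE.le,
      Real.norm_eq_abs, abs_mul, abs_mul]
    have h1 : |qPoch (q ^ 2) (2 * n)| ≤ 1 := by
      rw [abs_of_pos (qPoch_pos ht0 ht1 _)]
      simpa [qPoch] using qPoch_antitone ht0 ht1 (Nat.zero_le (2 * n))
    gcongr
    · exact hinv _
    · exact hinv _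

/-- The roots of `ω ^ n = -1`. -/
noncomputable def negRoot (n j : ℕ) : ℂ := Complex.exp (π * (2 * j + 1) / n * Complex.I)

lemma negRoot_pow {n : ℕ} (hn : 0 < n) (j : ℕ) : negRoot n j ^ n = -1 := by
  have hn' : (n : ℂ) ≠ 0 := by exact_mod_cast hn.ne'
  rw [negRoot, ← Complex.exp_nat_mul,
    show (n : ℂ) * (π * (2 * j + 1) / n * Complex.I) =
      π * Complex.I + (j : ℕ) * (2 * π * Complex.I) by field_simp; ring,
    Complex.exp_add, Complex.exp_nat_mul_two_pi_mul_I, Complex.exp_pi_mul_I, mul_one]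

lemma norm_negRoot (n j : ℕ) : ‖negRoot n j‖ = 1 := by
  rw [negRoot, show (π * (2 * j + 1) / n * Complex.I : ℂ) =
    ((π * (2 * j + 1) / n : ℝ) : ℂ) * Complex.I by push_cast; ring]
  exact Complex.norm_exp_ofReal_mul_I _

lemma negRoot_ne_zero (n j : ℕ) : negRoot n j ≠ 0 := Complex.exp_ne_zero _

lemma exp_pow_mul_negRoot_zero (n j : ℕ) :
    Complex.exp (2 * π * Complex.I / n) ^ j * negRoot n 0 = negRoot n j := by
  rw [negRoot, negRoot, ← Complex.exp_nat_mul, ← Complex.exp_add]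
  congr 1
  push_cast
  ring

lemma prod_one_sub_mul_negRoot {n : ℕ} (hn : 0 < n) (c : ℂ) :
    ∏ j ∈ Finset.range n, (1 - c * negRoot n j) = 1 + c ^ n := by
  have hprim := Complex.isPrimitiveRoot_exp n hn.ne'
  rcases eq_or_ne c 0 with rfl | hc
  · simp [hn.ne']
  have h := congrArg (Polynomial.eval c⁻¹)
    (X_pow_sub_C_eq_prod hprim hn (negRoot_pow hn 0))
  rw [Polynomial.eval_prod] at h
  simp only [Polynomial.eval_sub, Polynomial.eval_pow, Polynomial.eval_X, Polynomial.eval_C] at h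
  simp only [exp_pow_mul_negRoot_zero] at h
  calc ∏ j ∈ Finset.range n, (1 - c * negRoot n j)
      = ∏ j ∈ Finset.range n, (c * (c⁻¹ - negRoot n j)) := by
        refine Finset.prod_congr rfl fun j _ => ?_
        rw [mul_sub, mul_inv_cancel₀ hc]
    _ = c ^ n * (c⁻¹ ^ n - -1) := by
        rw [Finset.prod_mul_distrib, Finset.prod_const, Finset.card_range, h]
    _ = _ := by rw [inv_pow, mul_sub, mul_inv_cancel₀ (pow_ne_zero _ hc)]; ring

lemma negRoot_reflect {n j : ℕ} (hj : j < n) : negRoot n (n - 1 - j) = (negRoot n j)⁻¹ := by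
  have hn' : (n : ℂ) ≠ 0 := by exact_mod_cast (by omega : n ≠ 0)
  have h1 : ((n - 1 - j : ℕ) : ℂ) = n - 1 - j := by
    rw [Nat.sub_sub, Nat.cast_sub (by omega)]; push_cast; ring
  rw [negRoot, negRoot, ← Complex.exp_neg, h1,
    show (π * (2 * (n - 1 - j) + 1) / n * Complex.I : ℂ) =
      -(π * (2 * j + 1) / n * Complex.I) + 2 * π * Complex.I by field_simp; ring,
    Complex.exp_periodic]

lemma prod_one_sub_mul_inv_negRoot {n : ℕ} (hn : 0 < n) (c : ℂ) :
    ∏ j ∈ Finset.range n, (1 - c * (negRoot n j)⁻¹) = 1 + c ^ n := by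
  rw [← prod_one_sub_mul_negRoot hn c, ← Finset.prod_range_reflect]
  refine Finset.prod_congr rfl fun j hj => ?_
  rw [negRoot_reflect (Finset.mem_range.1 hj), inv_inv]

lemma prod_tripleProd {N : ℕ} (hN : 0 < N) (q : ℝ) (n : ℕ) (z : ℂ) :
    ∏ j ∈ Finset.range N, tripleProd q n (-(z * negRoot N j)) =
      ∏ l ∈ Finset.range n,
        ((1 + z ^ N * (q ^ N) ^ (2 * l + 1)) * (1 + z⁻¹ ^ N * (q ^ N) ^ (2 * l + 1))) := by
  unfold tripleProd
  rw [Finset.prod_comm]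
  refine Finset.prod_congr rfl fun l _ => ?_
  rw [Finset.prod_mul_distrib]
  congr 1
  · rw [← pow_mul, mul_comm N, pow_mul, ← mul_pow, ← prod_one_sub_mul_negRoot hN]
    refine Finset.prod_congr rfl fun j _ => by ring
  · rw [← pow_mul, mul_comm N, pow_mul, ← mul_pow, ← prod_one_sub_mul_inv_negRoot hN]
    refine Finset.prod_congr rfl fun j _ => ?_
    rw [inv_neg, mul_inv]; ring

lemma norm_one_add_mul_le {Z : ℂ} (hZ : ‖Z‖ = 1) {a b : ℝ} (hb : 0 ≤ b) (hab : b ≤ a)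
    (ha : a ≤ 1) : (1 - a) * ‖1 + Z * b‖ ≤ (1 - b) * ‖1 + Z * a‖ := by
  have hsq : ∀ x : ℝ, ‖1 + Z * x‖ ^ 2 = 1 + 2 * x * Z.re + x ^ 2 := by
    intro x
    have h1 : Z.re ^ 2 + Z.im ^ 2 = 1 := by
      rw [← one_pow 2, ← hZ, Complex.sq_norm, Complex.normSq_apply]; ring
    rw [Complex.sq_norm, Complex.normSq_apply]
    simp
    linear_combination x ^ 2 * h1
  have hre : -1 ≤ Z.re := by
    have := Complex.abs_re_le_norm Z
    rw [hZ] at this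
    exact (abs_le.1 this).1
  refine abs_le_of_sq_le_sq' ?_ (mul_nonneg (by linarith) (norm_nonneg _)) |>.2
  rw [mul_pow, mul_pow, hsq, hsq]
  have h1 : 0 ≤ (1 + Z.re) * (a - b) * (1 - a * b) :=
    mul_nonneg (mul_nonneg (by linarith) (by linarith)) (by nlinarith)
  nlinarith [h1]

lemma prod_norm_le_even {Z : ℂ} (hZ : ‖Z‖ = 1) {p : ℝ} (hp0 : 0 ≤ p) (hp1 : p < 1) (n : ℕ) :
    (1 - p) * ∏ l ∈ Finset.range n, ‖1 + Z * ((p ^ (2 * l + 2) : ℝ) : ℂ)‖ ≤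
      (1 - p ^ (2 * n + 1)) * ∏ l ∈ Finset.range n, ‖1 + Z * ((p ^ (2 * l + 1) : ℝ) : ℂ)‖ := by
  induction n with
  | zero => simp
  | succ n ih =>
    rw [Finset.prod_range_succ, Finset.prod_range_succ]
    have h := norm_one_add_mul_le hZ (pow_nonneg hp0 (2 * n + 2))
      (pow_le_pow_of_le_one hp0 hp1.le (by omega : 2 * n + 1 ≤ 2 * n + 2))
      (pow_le_one₀ hp0 hp1.le)
    have h3 : 1 - p ^ (2 * n + 2) ≤ 1 - p ^ (2 * (n + 1) + 1) := by
      have := pow_le_pow_of_le_one hp0 hp1.le (by omega : 2 * n + 2 ≤ 2 * (n + 1) + 1)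
      linarith
    set A := ∏ l ∈ Finset.range n, ‖1 + Z * ((p ^ (2 * l + 2) : ℝ) : ℂ)‖
    set B := ∏ l ∈ Finset.range n, ‖1 + Z * ((p ^ (2 * l + 1) : ℝ) : ℂ)‖
    have hB : 0 ≤ B := Finset.prod_nonneg fun _ _ => norm_nonneg _
    calc (1 - p) * (A * ‖1 + Z * ((p ^ (2 * n + 2) : ℝ) : ℂ)‖)
        = ((1 - p) * A) * ‖1 + Z * ((p ^ (2 * n + 2) : ℝ) : ℂ)‖ := by ring
      _ ≤ ((1 - p ^ (2 * n + 1)) * B) * ‖1 + Z * ((p ^ (2 * n + 2) : ℝ) : ℂ)‖ := by gcongr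
      _ = B * ((1 - p ^ (2 * n + 1)) * ‖1 + Z * ((p ^ (2 * n + 2) : ℝ) : ℂ)‖) := by ring
      _ ≤ B * ((1 - p ^ (2 * n + 2)) * ‖1 + Z * ((p ^ (2 * n + 1) : ℝ) : ℂ)‖) := by gcongr
      _ ≤ B * ((1 - p ^ (2 * (n + 1) + 1)) * ‖1 + Z * ((p ^ (2 * n + 1) : ℝ) : ℂ)‖) := by gcongr
      _ = _ := by ring

lemma prod_norm_le_odd {Z : ℂ} (hZ : ‖Z‖ = 1) {p : ℝ} (hp0 : 0 ≤ p) (hp1 : p < 1) (n : ℕ) :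
    (1 - p) ^ 2 * ∏ l ∈ Finset.range n, ‖1 + Z * ((p ^ (2 * l) : ℝ) : ℂ)‖ ≤
      2 * ∏ l ∈ Finset.range n, ‖1 + Z * ((p ^ (2 * l + 1) : ℝ) : ℂ)‖ := by
  rcases n with _ | n
  · simp; nlinarith
  have h2 : ‖1 + Z * ((p ^ (2 * 0) : ℝ) : ℂ)‖ ≤ 2 := by
    refine (norm_add_le _ _).trans ?_
    simp [hZ]; norm_num
  have hlast : 1 - p ≤ ‖1 + Z * ((p ^ (2 * n + 1) : ℝ) : ℂ)‖ := by
    have h := norm_sub_norm_le (1 : ℂ) (-(Z * ((p ^ (2 * n + 1) : ℝ) : ℂ)))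
    rw [sub_neg_eq_add, norm_neg, norm_mul, hZ, norm_one, one_mul, Complex.norm_real,
      Real.norm_of_nonneg (pow_nonneg hp0 _)] at h
    have := pow_le_of_le_one hp0 hp1.le (by omega : 2 * n + 1 ≠ 0)
    linarith
  have h := prod_norm_le_even hZ hp0 hp1 n
  rw [Finset.prod_range_succ', Finset.prod_range_succ]
  simp only [mul_add, mul_one]
  have hB : 0 ≤ ∏ l ∈ Finset.range n, ‖1 + Z * ((p ^ (2 * l + 1) : ℝ) : ℂ)‖ :=
    Finset.prod_nonneg fun _ _ => norm_nonneg _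
  have hA : 0 ≤ ∏ l ∈ Finset.range n, ‖1 + Z * ((p ^ (2 * l + 2) : ℝ) : ℂ)‖ :=
    Finset.prod_nonneg fun _ _ => norm_nonneg _
  have hp : 0 ≤ 1 - p := by linarith
  have hpn := pow_nonneg hp0 (2 * n + 1)
  generalize ∏ l ∈ Finset.range n, ‖1 + Z * ((p ^ (2 * l + 2) : ℝ) : ℂ)‖ = A at *
  generalize ∏ l ∈ Finset.range n, ‖1 + Z * ((p ^ (2 * l + 1) : ℝ) : ℂ)‖ = B at *
  generalize ‖1 + Z * ((p ^ (2 * 0) : ℝ) : ℂ)‖ = x at *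
  generalize ‖1 + Z * ((p ^ (2 * n + 1) : ℝ) : ℂ)‖ = y at *
  have h3 : (1 - p) * A ≤ B := h.trans (mul_le_of_le_one_left hB (by linarith))
  calc (1 - p) ^ 2 * (A * x) ≤ (1 - p) ^ 2 * (A * 2) := by gcongr
    _ = 2 * (1 - p) * ((1 - p) * A) := by ring
    _ ≤ 2 * (1 - p) * B := by gcongr
    _ = 2 * (B * (1 - p)) := by ring
    _ ≤ 2 * (B * y) := by gcongr

lemma prod_norm_tripleProd_le {N : ℕ} (hN : 0 < N) {Q : ℝ} (hQ0 : 0 < Q)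
    (hQ1 : Q < 1) {z : ℂ} (hz : ‖z‖ = 1) (n : ℕ) :
    (1 - Q ^ N) ^ 3 * ∏ j ∈ Finset.range N, ‖tripleProd Q n (-(Q * z * negRoot N j))‖ ≤
      2 * ∏ j ∈ Finset.range N, ‖tripleProd Q n (-(z * negRoot N j))‖ := by
  have hz0 : z ≠ 0 := by rintro rfl; simp at hz
  have hQc : (Q : ℂ) ≠ 0 := by exact_mod_cast hQ0.ne'
  rw [← norm_prod, ← norm_prod, prod_tripleProd hN, prod_tripleProd hN, norm_prod, norm_prod]
  set p := Q ^ N with hp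
  have hp0 : 0 < p := pow_pos hQ0 _
  have hp1 : p < 1 := pow_lt_one₀ hQ0.le hQ1 hN.ne'
  set Z := z ^ N with hZdef
  have hZ : ‖Z‖ = 1 := by rw [hZdef, norm_pow, hz, one_pow]
  have hinv : ∀ x : ℝ, ‖1 + Z⁻¹ * x‖ = ‖1 + Z * x‖ := by
    intro x
    rw [Complex.inv_eq_conj hZ, ← Complex.norm_conj]
    simp
  have hnum : ∀ l : ℕ, ‖(1 + ((Q : ℂ) * z) ^ N * ((Q : ℂ) ^ N) ^ (2 * l + 1)) *
      (1 + ((Q : ℂ) * z)⁻¹ ^ N * ((Q : ℂ) ^ N) ^ (2 * l + 1))‖ =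
      ‖1 + Z * ((p ^ (2 * l + 2) : ℝ) : ℂ)‖ * ‖1 + Z * ((p ^ (2 * l) : ℝ) : ℂ)‖ := by
    intro l
    rw [norm_mul]
    congr 1
    · congr 2; rw [mul_pow]; push_cast [hp]; ring
    · rw [← hinv (p ^ (2 * l))]; congr 2
      rw [hZdef, mul_inv, mul_pow, inv_pow, inv_pow]; push_cast [hp]; field_simp; ring
  have hden : ∀ l : ℕ, ‖(1 + Z * ((Q : ℂ) ^ N) ^ (2 * l + 1)) *
      (1 + z⁻¹ ^ N * ((Q : ℂ) ^ N) ^ (2 * l + 1))‖ =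
      ‖1 + Z * ((p ^ (2 * l + 1) : ℝ) : ℂ)‖ * ‖1 + Z * ((p ^ (2 * l + 1) : ℝ) : ℂ)‖ := by
    intro l
    rw [norm_mul]
    congr 1
    · congr 2; push_cast [hp]; ring
    · rw [← hinv (p ^ (2 * l + 1))]; congr 2
      rw [inv_pow, ← hZdef]; push_cast [hp]; ring
  simp only [hnum, hden, Finset.prod_mul_distrib]
  have h1 := prod_norm_le_even hZ hp0.le hp1 n
  have h2 := prod_norm_le_odd hZ hp0.le hp1 n
  set A := ∏ l ∈ Finset.range n, ‖1 + Z * ((p ^ (2 * l + 2) : ℝ) : ℂ)‖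
  set A' := ∏ l ∈ Finset.range n, ‖1 + Z * ((p ^ (2 * l) : ℝ) : ℂ)‖
  set B := ∏ l ∈ Finset.range n, ‖1 + Z * ((p ^ (2 * l + 1) : ℝ) : ℂ)‖
  have hB : 0 ≤ B := Finset.prod_nonneg fun _ _ => norm_nonneg _
  have hA : 0 ≤ A := Finset.prod_nonneg fun _ _ => norm_nonneg _
  have hA' : 0 ≤ A' := Finset.prod_nonneg fun _ _ => norm_nonneg _
  have hpp : 0 ≤ 1 - p := by linarith
  have h3 : (1 - p) * A ≤ B := h1.trans (mul_le_of_le_one_left hB (by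
    have := pow_nonneg hp0.le (2 * n + 1); linarith))
  calc (1 - p) ^ 3 * (A * A') = ((1 - p) * A) * ((1 - p) ^ 2 * A') := by ring
    _ ≤ B * (2 * B) := by gcongr
    _ = _ := by ring

lemma ofReal_gaussSum_eq_theta {T : ℝ} (hT : 0 < T) (x : ℝ) :
    (gaussSum T x : ℂ) = ((T ^ (1 / 2 : ℝ) : ℝ) : ℂ) *
      theta (Real.exp (-π * T)) (Complex.exp (2 * π * Complex.I * x)) := by
  rw [ofReal_gaussSum hT, theta_exp]

lemma exp_add_half (x : ℝ) : Complex.exp (2 * π * Complex.I * ((x + 1 / 2 : ℝ) : ℂ)) =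
    -Complex.exp (2 * π * Complex.I * x) := by
  rw [show 2 * π * Complex.I * ((x + 1 / 2 : ℝ) : ℂ) =
    2 * π * Complex.I * x + π * Complex.I by push_cast; ring, Complex.exp_add,
    Complex.exp_pi_mul_I, mul_neg_one]

lemma theta_exp_ne_zero {T : ℝ} (hT : 0 < T) (x : ℝ) :
    theta (Real.exp (-π * T)) (Complex.exp (2 * π * Complex.I * x)) ≠ 0 := by
  intro h
  have h1 := ofReal_gaussSum_eq_theta hT x
  rw [h, mul_zero] at h1
  exact (gaussSum_pos hT x).ne' (by exact_mod_cast h1)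

lemma gaussSum_addition {T : ℝ} (hT : 0 < T) (x y : ℝ) {q : ℝ} (hq : q = Real.exp (-π * T))
    {z w : ℂ} (hz : z = Complex.exp (2 * π * Complex.I * x))
    (hw : w = Complex.exp (2 * π * Complex.I * y)) :
    |gaussSum T x * gaussSum T (y + 1 / 2) - gaussSum T (x + 1 / 2) * gaussSum T y| *
        (‖theta (q ^ 2) (-(z * w))‖ * ‖theta (q ^ 2) (-(z * w⁻¹))‖) =
      q * (‖theta (q ^ 2) (-((q : ℂ) ^ 2 * z * w))‖ * ‖theta (q ^ 2) (-((q : ℂ) ^ 2 * z * w⁻¹))‖) *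
        (gaussSum T x * gaussSum T (y + 1 / 2) + gaussSum T (x + 1 / 2) * gaussSum T y) := by
  have hq0 : 0 < q := hq ▸ Real.exp_pos _
  have hq1 : q < 1 := by
    rw [hq, Real.exp_lt_one_iff]
    have := mul_pos Real.pi_pos hT
    linarith
  have hz0 : z ≠ 0 := hz ▸ Complex.exp_ne_zero _
  have hw0 : w ≠ 0 := hw ▸ Complex.exp_ne_zero _
  have hzn : ‖z‖ = 1 := by
    rw [hz, show 2 * π * Complex.I * (x : ℂ) = ((2 * π * x : ℝ) : ℂ) * Complex.I by
      push_cast; ring]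
    exact Complex.norm_exp_ofReal_mul_I _
  set c : ℝ := T ^ (1 / 2 : ℝ)
  have hG : ∀ u : ℝ, (gaussSum T u : ℂ) = (c : ℂ) * theta q (Complex.exp (2 * π * Complex.I * u)) := by
    intro u
    rw [hq]
    exact ofReal_gaussSum_eq_theta hT u
  have h1 := theta_mul_sub hq0 hq1 hz0 hw0
  have h2 := theta_mul_add hq0 hq1 hz0 hw0
  have hsub : ((gaussSum T x * gaussSum T (y + 1 / 2) -
      gaussSum T (x + 1 / 2) * gaussSum T y : ℝ) : ℂ) =
      (c : ℂ) ^ 2 * (2 * q * z * (theta (q ^ 2) (-((q : ℂ) ^ 2 * (z * w))) *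
        theta (q ^ 2) (-((q : ℂ) ^ 2 * (z / w))))) := by
    rw [← h1]
    push_cast [hG]
    rw [show (x : ℂ) + 1 / 2 = ((x + 1 / 2 : ℝ) : ℂ) by push_cast; ring,
      show (y : ℂ) + 1 / 2 = ((y + 1 / 2 : ℝ) : ℂ) by push_cast; ring,
      exp_add_half, exp_add_half, ← hz, ← hw]
    ring
  have hadd : ((gaussSum T x * gaussSum T (y + 1 / 2) +
      gaussSum T (x + 1 / 2) * gaussSum T y : ℝ) : ℂ) =
      (c : ℂ) ^ 2 * (2 * (theta (q ^ 2) (-(z * w)) * theta (q ^ 2) (-(z / w)))) := by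
    rw [← h2]
    push_cast [hG]
    rw [show (x : ℂ) + 1 / 2 = ((x + 1 / 2 : ℝ) : ℂ) by push_cast; ring,
      show (y : ℂ) + 1 / 2 = ((y + 1 / 2 : ℝ) : ℂ) by push_cast; ring,
      exp_add_half, exp_add_half, ← hz, ← hw]
    ring
  have hpos := gaussSum_pos hT
  have hnn : 0 ≤ gaussSum T x * gaussSum T (y + 1 / 2) +
      gaussSum T (x + 1 / 2) * gaussSum T y :=
    add_nonneg (mul_pos (hpos _) (hpos _)).le (mul_pos (hpos _) (hpos _)).le
  have hsub' := congrArg norm hsub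
  have hadd' := congrArg norm hadd
  rw [Complex.norm_real, Real.norm_eq_abs] at hsub' hadd'
  rw [abs_of_nonneg hnn] at hadd'
  rw [hsub', hadd']
  simp only [norm_mul, hzn, Complex.norm_real, Real.norm_of_nonneg hq0.le, div_eq_mul_inv,
    mul_assoc]
  ring

lemma prod_mul_prod_inv_negRoot {k : ℕ} (g : ℂ → ℝ) :
    ∏ j ∈ Finset.range k, (g (negRoot (2 * k) j) * g (negRoot (2 * k) j)⁻¹) =
      ∏ j ∈ Finset.range (2 * k), g (negRoot (2 * k) j) := by
  rw [Finset.prod_mul_distrib]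
  conv_rhs => rw [two_mul, Finset.prod_range_add, ← two_mul]
  congr 1
  rw [← Finset.prod_range_reflect (fun j => g (negRoot (2 * k) (k + j)))]
  refine Finset.prod_congr rfl fun j hj => ?_
  have hj := Finset.mem_range.1 hj
  rw [← negRoot_reflect (by omega : j < 2 * k)]
  congr 2
  omega

lemma prod_norm_theta_le {N : ℕ} (hN : 0 < N) {Q : ℝ} (hQ0 : 0 < Q)
    (hQ1 : Q < 1) {z : ℂ} (hz : ‖z‖ = 1) :
    (1 - Q ^ N) ^ 3 * ∏ j ∈ Finset.range N, ‖theta Q (-(Q * z * negRoot N j))‖ ≤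
      2 * ∏ j ∈ Finset.range N, ‖theta Q (-(z * negRoot N j))‖ := by
  have hz0 : z ≠ 0 := by rintro rfl; simp at hz
  have hQc : (Q : ℂ) ≠ 0 := by exact_mod_cast hQ0.ne'
  obtain ⟨C, hC⟩ := exists_tendsto_tripleProd hQ0 hQ1
  have hlim : ∀ u : ℂ, u ≠ 0 → Filter.Tendsto
      (fun n => ∏ j ∈ Finset.range N, ‖(C : ℂ) * tripleProd Q n (-(u * negRoot N j))‖) Filter.atTop
      (nhds (∏ j ∈ Finset.range N, ‖theta Q (-(u * negRoot N j))‖)) := fun u hu =>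
    tendsto_finsetProd _ fun j _ =>
      (hC _ (neg_ne_zero.2 (mul_ne_zero hu (negRoot_ne_zero _ _)))).norm
  refine le_of_tendsto_of_tendsto' ((hlim _ (mul_ne_zero hQc hz0)).const_mul _)
    ((hlim z hz0).const_mul _) fun n => ?_
  simp only [norm_mul, Finset.prod_mul_distrib, Finset.prod_const]
  have h := mul_le_mul_of_nonneg_left (prod_norm_tripleProd_le hN hQ0 hQ1 hz n)
    (pow_nonneg (norm_nonneg (C : ℂ)) (Finset.range N).card)
  linarith

/-- An explicit rational function that is small on `[1 / b, b]` and large on `[-b, -1 / b]`. -/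
lemma exists_zolotarev {T b : ℝ} (hT : 0 < T) (hb : 0 < b) (hbT : 2 * b ≤ Real.exp (π / (4 * T)))
    {q : ℝ} (hq : q = Real.exp (-π * T)) {k : ℕ} (hk : 0 < k) :
    ∃ a : ℕ → ℝ, (∀ j, 0 < a j) ∧ ∀ t, 1 / b ≤ t → t ≤ b →
      (1 - q ^ (4 * k)) ^ 3 * ∏ j ∈ Finset.range k, |t - a j| ≤
        2 * q ^ k * ∏ j ∈ Finset.range k, (t + a j) := by
  have hpos := gaussSum_pos hT
  have hq0 : 0 < q := hq ▸ Real.exp_pos _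
  have hq1 : q < 1 := by
    rw [hq, Real.exp_lt_one_iff]
    have := mul_pos Real.pi_pos hT
    linarith
  let y : ℕ → ℝ := fun j => (2 * j + 1) / (2 * (2 * k : ℕ))
  have hy : ∀ j, negRoot (2 * k) j = Complex.exp (2 * π * Complex.I * (y j : ℝ)) := by
    intro j
    rw [negRoot]
    congr 1
    simp only [y]
    push_cast
    field_simp
  refine ⟨fun j => gaussSum T (y j) / gaussSum T (y j + 1 / 2), fun j => div_pos (hpos _) (hpos _),
    fun t ht1 ht2 => ?_⟩
  obtain ⟨x, rfl⟩ := exists_gaussSum_quotient hT hb hbT ht1 ht2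
  set z := Complex.exp (2 * π * Complex.I * x) with hz
  have hzn : ‖z‖ = 1 := by
    rw [hz, show 2 * π * Complex.I * (x : ℂ) = ((2 * π * x : ℝ) : ℂ) * Complex.I by
      push_cast; ring]
    exact Complex.norm_exp_ofReal_mul_I _
  set ω := negRoot (2 * k) with hω
  let D : ℂ → ℝ := fun w => ‖theta (q ^ 2) (-(z * w))‖
  let M : ℂ → ℝ := fun w => ‖theta (q ^ 2) (-((q : ℂ) ^ 2 * z * w))‖
  have hfac : ∀ j, |gaussSum T x / gaussSum T (x + 1 / 2) -
      gaussSum T (y j) / gaussSum T (y j + 1 / 2)| * (D (ω j) * D (ω j)⁻¹) =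
      q * (M (ω j) * M (ω j)⁻¹) * (gaussSum T x / gaussSum T (x + 1 / 2) +
        gaussSum T (y j) / gaussSum T (y j + 1 / 2)) := by
    intro j
    have h := gaussSum_addition hT x (y j) hq hz (hy j)
    have hx := hpos (x + 1 / 2)
    have hyj := hpos (y j + 1 / 2)
    rw [div_sub_div _ _ hx.ne' hyj.ne', div_add_div _ _ hx.ne' hyj.ne', abs_div,
      abs_of_pos (mul_pos hx hyj), div_mul_eq_mul_div, h]
    ring
  have hprod : (∏ j ∈ Finset.range k, |gaussSum T x / gaussSum T (x + 1 / 2) -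
      gaussSum T (y j) / gaussSum T (y j + 1 / 2)|) * ∏ j ∈ Finset.range (2 * k), D (ω j) =
      q ^ k * (∏ j ∈ Finset.range (2 * k), M (ω j)) *
        ∏ j ∈ Finset.range k, (gaussSum T x / gaussSum T (x + 1 / 2) +
          gaussSum T (y j) / gaussSum T (y j + 1 / 2)) := by
    rw [← prod_mul_prod_inv_negRoot D, ← prod_mul_prod_inv_negRoot M, ← Finset.prod_mul_distrib,
      Finset.prod_congr rfl fun j _ => hfac j, Finset.prod_mul_distrib, Finset.prod_mul_distrib,
      Finset.prod_const, Finset.card_range]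
  have hle := prod_norm_theta_le (by omega : 0 < 2 * k) (pow_pos hq0 2)
    (pow_lt_one₀ hq0.le hq1 two_ne_zero) hzn
  rw [← pow_mul, show 2 * (2 * k) = 4 * k by ring, Complex.ofReal_pow] at hle
  have hD : 0 < ∏ j ∈ Finset.range (2 * k), D (ω j) := by
    refine Finset.prod_pos fun j _ => norm_pos_iff.2 ?_
    have h := theta_exp_ne_zero (mul_pos two_pos hT) (x + y j + 1 / 2)
    rwa [exp_add_half, show Real.exp (-π * (2 * T)) = q ^ 2 by
      rw [hq, ← Real.exp_nat_mul]; congr 1; push_cast; ring, Complex.ofReal_add, mul_add,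
      Complex.exp_add, ← hy, ← hz] at h
  have hS : 0 ≤ ∏ j ∈ Finset.range k, (gaussSum T x / gaussSum T (x + 1 / 2) +
      gaussSum T (y j) / gaussSum T (y j + 1 / 2)) :=
    Finset.prod_nonneg fun j _ => (add_pos (div_pos (hpos _) (hpos _))
      (div_pos (hpos _) (hpos _))).le
  refine le_of_mul_le_mul_right ?_ hD
  have h3 := mul_le_mul_of_nonneg_left hle (mul_nonneg (pow_nonneg hq0.le k) hS)
  rw [mul_assoc, hprod]
  linarith

lemma abs_mul_le_of_abs_le {s A B : ℝ} (hs : 0 < s) (hs1 : s ≤ 1 / 4)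
    (h : (1 - s ^ 4) ^ 3 * |A| ≤ 2 * s * |B|) : |A * B| ≤ 2 * s * (A ^ 2 + B ^ 2) := by
  have hB := abs_nonneg B
  have hA := abs_nonneg A
  have hs2 : s ^ 2 ≤ 1 / 16 := by nlinarith
  have hs4 : s ^ 4 ≤ s ^ 2 / 16 := by nlinarith [pow_pos hs 2]
  have hc : 1 ≤ (1 - s ^ 4) ^ 3 * (1 + 4 * s ^ 2) := by
    have h1 : 1 - 3 * s ^ 4 ≤ (1 - s ^ 4) ^ 3 := by
      have h8 : 0 ≤ (s ^ 4) ^ 2 * (3 - s ^ 4) := by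
        have : s ^ 4 ≤ 1 := by linarith
        exact mul_nonneg (sq_nonneg _) (by linarith)
      linarith
    have h2 : 1 ≤ (1 - 3 * s ^ 4) * (1 + 4 * s ^ 2) := by
      nlinarith [pow_pos hs 4, pow_pos hs 2]
    nlinarith [pow_pos hs 2]
  have h1 : |A| ≤ 2 * s * (1 + 4 * s ^ 2) * |B| := by
    have := mul_le_mul_of_nonneg_right hc hA
    have := mul_le_mul_of_nonneg_left h (by positivity : 0 ≤ 1 + 4 * s ^ 2)
    linarith
  rw [abs_mul, ← sq_abs A, ← sq_abs B]
  rcases le_total |A| (2 * s * |B|) with h2 | h2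
  · have := mul_le_mul_of_nonneg_right h2 hB
    nlinarith [mul_nonneg hs.le (sq_nonneg |A|)]
  · have h3 := mul_le_mul_of_nonneg_right h1 hB
    have h4 : (2 * s * |B|) ^ 2 ≤ |A| ^ 2 := by gcongr
    have h5 := mul_le_mul_of_nonneg_left h4 hs.le
    nlinarith

lemma exists_zolotarev_abs {T b : ℝ} (hT : 0 < T) (hb : 0 < b)
    (hbT : 2 * b ≤ Real.exp (π / (4 * T))) {q : ℝ} (hq : q = Real.exp (-π * T)) {k : ℕ}
    (hk : 0 < k) (hs : q ^ k ≤ 1 / 4) :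
    ∃ a : ℕ → ℝ, (∀ j, 0 < a j) ∧ ∀ t, 1 / b ≤ |t| → |t| ≤ b →
      |(∏ j ∈ Finset.range k, (t - a j)) * ∏ j ∈ Finset.range k, (t + a j)| ≤
        2 * q ^ k * ((∏ j ∈ Finset.range k, (t - a j)) ^ 2 +
          (∏ j ∈ Finset.range k, (t + a j)) ^ 2) := by
  obtain ⟨a, ha, h⟩ := exists_zolotarev hT hb hbT hq hk
  refine ⟨a, ha, fun t ht1 ht2 => ?_⟩
  have hq0 : 0 < q ^ k := pow_pos (hq ▸ Real.exp_pos _) _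
  have key := h |t| ht1 ht2
  rw [mul_comm 4 k, pow_mul] at key
  rcases le_total 0 t with ht | ht
  · rw [abs_of_nonneg ht] at key
    refine abs_mul_le_of_abs_le hq0 hs ?_
    rw [Finset.abs_prod]
    exact key.trans (mul_le_mul_of_nonneg_left (le_abs_self _) (by positivity))
  · rw [abs_of_nonpos ht] at key
    rw [mul_comm (∏ j ∈ Finset.range k, (t - a j)), add_comm (_ ^ 2)]
    refine abs_mul_le_of_abs_le hq0 hs ?_
    rw [Finset.abs_prod, Finset.abs_prod]
    have h1 : ∏ j ∈ Finset.range k, |-t - a j| = ∏ j ∈ Finset.range k, |t + a j| :=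
      Finset.prod_congr rfl fun j _ => by rw [← abs_neg]; congr 1; ring
    have h2 : ∏ j ∈ Finset.range k, (-t + a j) = ∏ j ∈ Finset.range k, |t - a j| :=
      Finset.prod_congr rfl fun j _ => by
        rw [abs_of_nonpos (by linarith [ha j])]; ring
    rwa [h1, h2] at key

open Polynomial in
lemma exists_re_im_polynomial (a : ℕ → ℝ) (k : ℕ) :
    ∃ u v : ℝ[X], u.natDegree ≤ k ∧ v.natDegree ≤ k ∧ ∀ ζ : ℂ,
      aeval ζ u + Complex.I * aeval ζ v =
        ∏ j ∈ Finset.range k, ((ζ - 1) - Complex.I * a j * (ζ + 1)) ∧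
      aeval ζ u - Complex.I * aeval ζ v =
        ∏ j ∈ Finset.range k, ((ζ - 1) + Complex.I * a j * (ζ + 1)) := by
  induction k with
  | zero => exact ⟨1, 0, by simp, by simp, by simp⟩
  | succ k ih =>
    obtain ⟨u, v, hu, hv, h⟩ := ih
    refine ⟨u * (X - 1) + C (a k) * (v * (X + 1)), v * (X - 1) - C (a k) * (u * (X + 1)),
      ?_, ?_, fun ζ => ⟨?_, ?_⟩⟩
    · have h1 : (X - 1 : ℝ[X]).natDegree ≤ 1 := by compute_degree
      have h2 : (X + 1 : ℝ[X]).natDegree ≤ 1 := by compute_degree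
      exact natDegree_add_le_of_degree_le (natDegree_mul_le_of_le hu h1)
        ((natDegree_C_mul_le _ _).trans (natDegree_mul_le_of_le hv h2))
    · have h1 : (X - 1 : ℝ[X]).natDegree ≤ 1 := by compute_degree
      have h2 : (X + 1 : ℝ[X]).natDegree ≤ 1 := by compute_degree
      exact (natDegree_sub_le_of_le (natDegree_mul_le_of_le hv h1)
        ((natDegree_C_mul_le _ _).trans (natDegree_mul_le_of_le hu h2))).trans (max_self _).le
    · rw [Finset.prod_range_succ, ← (h ζ).1]
      simp
      linear_combination ((aeval ζ) v * a k * (ζ + 1)) * Complex.I_sq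
    · rw [Finset.prod_range_succ, ← (h ζ).2]
      simp
      linear_combination ((aeval ζ) v * a k * (ζ + 1)) * Complex.I_sq

lemma mul_abs_cos_le_sin {δ x : ℝ} (hδ : 0 < δ) (h1 : δ ≤ x) (h2 : x ≤ π - δ) :
    δ * |cos x| ≤ sin x := by
  have key : ∀ y, δ ≤ y → y ≤ π / 2 → δ * |cos y| ≤ sin y := by
    intro y hy1 hy2
    have hc : 0 ≤ cos y := cos_nonneg_of_mem_Icc ⟨by linarith, hy2⟩
    rw [abs_of_nonneg hc]
    rcases hy2.eq_or_lt with rfl | hlt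
    · simp
    · have hc' : 0 < cos y := cos_pos_of_mem_Ioo ⟨by linarith, hlt⟩
      have := Real.le_tan (by linarith : 0 ≤ y) hlt
      rw [tan_eq_sin_div_cos, le_div_iff₀ hc'] at this
      nlinarith
  rcases le_total x (π / 2) with h | h
  · exact key x h1 h
  · have := key (π - x) (by linarith) (by linarith)
    rwa [cos_pi_sub, sin_pi_sub, abs_neg] at this

lemma exists_cayley {m l : ℕ} (hl : l < 2 * m) :
    ∃ t : ℝ, negRoot (2 * m) l - 1 = Complex.I * t * (negRoot (2 * m) l + 1) ∧
      1 / (4 * m / π) ≤ |t| ∧ |t| ≤ 4 * m / π := by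
  have hm : 0 < m := by omega
  have hm' : (0 : ℝ) < m := by exact_mod_cast hm
  have hpi := Real.pi_pos
  set δ : ℝ := π / (4 * m) with hδ
  have hδ0 : 0 < δ := by positivity
  set φ : ℝ := δ * (2 * l + 1) with hφ
  have hπ : π = δ * (4 * m) := by rw [hδ]; field_simp
  have hl' : (l : ℝ) + 1 ≤ 2 * m := by exact_mod_cast hl
  have hl0 : (0 : ℝ) ≤ l := Nat.cast_nonneg l
  have hsin : δ * |cos φ| ≤ sin φ :=
    mul_abs_cos_le_sin hδ0 (by nlinarith) (by rw [hπ]; nlinarith)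
  have hcos : δ * |sin φ| ≤ |cos φ| := by
    rcases lt_or_ge l m with h | h
    · have h' : (l : ℝ) + 1 ≤ m := by exact_mod_cast h
      have := mul_abs_cos_le_sin hδ0 (x := π / 2 - φ) (by rw [hπ]; nlinarith)
        (by rw [hπ]; nlinarith)
      rw [cos_pi_div_two_sub, sin_pi_div_two_sub] at this
      exact this.trans (le_abs_self _)
    · have h' : (m : ℝ) ≤ l := by exact_mod_cast h
      have := mul_abs_cos_le_sin hδ0 (x := φ - π / 2) (by rw [hπ]; nlinarith)
        (by rw [hπ]; nlinarith)
      rw [cos_sub_pi_div_two, sin_sub_pi_div_two] at this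
      exact this.trans (neg_le_abs _)
  have hsin' : δ * |cos φ| ≤ |sin φ| := hsin.trans (le_abs_self _)
  have hc : cos φ ≠ 0 := by
    intro h0
    rw [h0, abs_zero] at hcos
    have hs : sin φ = 0 := by
      have : |sin φ| ≤ 0 := by nlinarith [abs_nonneg (sin φ)]
      exact abs_nonpos_iff.1 this
    have := sin_sq_add_cos_sq φ
    rw [h0, hs] at this
    norm_num at this
  have hb : (4 * m / π : ℝ) = 1 / δ := by rw [hδ, one_div_div]
  have hcp := abs_pos.2 hc
  refine ⟨sin φ / cos φ, ?_, ?_, ?_⟩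
  · have hζ : negRoot (2 * m) l = (cos φ + sin φ * Complex.I : ℂ) ^ 2 := by
      rw [Complex.ofReal_cos, Complex.ofReal_sin, ← Complex.exp_mul_I, ← Complex.exp_nat_mul,
        negRoot, hφ, hδ]
      congr 1
      push_cast
      field_simp
      ring
    have hcc : (cos φ : ℂ) ≠ 0 := by exact_mod_cast hc
    have h1 : (cos φ : ℂ) ^ 2 + (sin φ : ℂ) ^ 2 = 1 := by
      exact_mod_cast cos_sq_add_sin_sq φ
    rw [hζ]
    push_cast only [Complex.ofReal_div]
    rw [mul_div_assoc', div_mul_eq_mul_div, eq_div_iff hcc]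
    have hI := Complex.I_sq
    generalize (cos φ : ℂ) = c at *
    generalize (sin φ : ℂ) = s at *
    linear_combination (c * s ^ 2 - Complex.I * s ^ 3 - 2 * s ^ 2 * c) * hI + (c + Complex.I * s) * h1
  · rw [hb, one_div_one_div, abs_div, le_div_iff₀ hcp]
    exact hsin'
  · rw [hb, abs_div, div_le_div_iff₀ hcp hδ0]
    linarith

open Polynomial in
lemma exists_filter {m k : ℕ} (hm : 0 < m) (hk : 0 < k) {q : ℝ}
    (hq : q = Real.exp (-(π ^ 2 / (4 * Real.log (8 * m / π))))) (hs : q ^ k ≤ 1 / 4) :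
    ∃ u v : ℝ[X], u.natDegree ≤ k ∧ v.natDegree ≤ k ∧ u ^ 2 - v ^ 2 ≠ 0 ∧
      ∀ l < 2 * m, ‖aeval (negRoot (2 * m) l) (u ^ 2 + v ^ 2)‖ ≤
        4 * q ^ k * ‖aeval (negRoot (2 * m) l) (u ^ 2 - v ^ 2)‖ := by
  have hm' : (1 : ℝ) ≤ m := by exact_mod_cast hm
  have hpi := Real.pi_pos
  have hL : 0 < Real.log (8 * m / π) := by
    refine Real.log_pos ?_
    rw [lt_div_iff₀ hpi]
    linarith [Real.pi_le_four]
  have hb : (0 : ℝ) < 4 * m / π := by positivity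
  have hT : 0 < π / (4 * Real.log (8 * m / π)) := by positivity
  have hbT : 2 * (4 * m / π) ≤ Real.exp (π / (4 * (π / (4 * Real.log (8 * m / π))))) := by
    rw [show π / (4 * (π / (4 * Real.log (8 * m / π)))) = Real.log (8 * m / π) by field_simp,
      Real.exp_log (by positivity)]
    exact (by ring : 2 * (4 * m / π) = 8 * m / π).le
  have hq' : q = Real.exp (-π * (π / (4 * Real.log (8 * m / π)))) := by
    rw [hq]; congr 1; ring
  have hq0 : 0 < q := hq ▸ Real.exp_pos _
  obtain ⟨a, ha, h⟩ := exists_zolotarev_abs hT hb hbT hq' hk hs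
  obtain ⟨u, v, hu, hv, huv⟩ := exists_re_im_polynomial a k
  have hN : ∀ ζ : ℂ, 2 * aeval ζ (u ^ 2 - v ^ 2) =
      (aeval ζ u + Complex.I * aeval ζ v) ^ 2 + (aeval ζ u - Complex.I * aeval ζ v) ^ 2 := by
    intro ζ
    simp only [map_sub, map_pow]
    linear_combination (-2 * (aeval ζ v) ^ 2) * Complex.I_sq
  have hM : ∀ ζ : ℂ, aeval ζ (u ^ 2 + v ^ 2) =
      (aeval ζ u + Complex.I * aeval ζ v) * (aeval ζ u - Complex.I * aeval ζ v) := by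
    intro ζ
    simp only [map_add, map_pow]
    linear_combination ((aeval ζ v) ^ 2) * Complex.I_sq
  refine ⟨u, v, hu, hv, fun h0 => ?_, fun l hl => ?_⟩
  · have h1 := hN 1
    rw [h0, map_zero, (huv 1).1, (huv 1).2, ← Finset.prod_pow, ← Finset.prod_pow] at h1
    have h2 : ∀ j, (1 - 1 - Complex.I * a j * (1 + 1)) ^ 2 = ((-(2 * a j) ^ 2 : ℝ) : ℂ) := by
      intro j; push_cast; linear_combination (4 * (a j : ℂ) ^ 2) * Complex.I_sq
    have h3 : ∀ j, (1 - 1 + Complex.I * a j * (1 + 1)) ^ 2 = ((-(2 * a j) ^ 2 : ℝ) : ℂ) := by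
      intro j; push_cast; linear_combination (4 * (a j : ℂ) ^ 2) * Complex.I_sq
    simp only [h2, h3] at h1
    rw [mul_zero, ← two_mul, eq_comm, mul_eq_zero, or_iff_right two_ne_zero,
      Finset.prod_eq_zero_iff] at h1
    obtain ⟨j, -, hj⟩ := h1
    have := ha j
    have hj' : -(2 * a j) ^ 2 = 0 := by exact_mod_cast hj
    nlinarith
  · obtain ⟨t, ht, ht1, ht2⟩ := exists_cayley hl
    set ζ := negRoot (2 * m) l
    have key := h t ht1 ht2
    set A := ∏ j ∈ Finset.range k, (t - a j)
    set B := ∏ j ∈ Finset.range k, (t + a j)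
    set c := (Complex.I * (ζ + 1)) ^ k
    have hA : aeval ζ u + Complex.I * aeval ζ v = c * A := by
      have h1 : ∀ x : ℝ, ζ - 1 - Complex.I * x * (ζ + 1) =
          Complex.I * (ζ + 1) * ((t - x : ℝ) : ℂ) := by
        intro x; rw [ht]; push_cast; ring
      simp only [(huv ζ).1, h1, A, c, Finset.prod_mul_distrib, Finset.prod_const,
        Finset.card_range, Complex.ofReal_prod, mul_pow]
    have hB : aeval ζ u - Complex.I * aeval ζ v = c * B := by
      have h1 : ∀ x : ℝ, ζ - 1 + Complex.I * x * (ζ + 1) =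
          Complex.I * (ζ + 1) * ((t + x : ℝ) : ℂ) := by
        intro x; rw [ht]; push_cast; ring
      simp only [(huv ζ).2, h1, B, c, Finset.prod_mul_distrib, Finset.prod_const,
        Finset.card_range, Complex.ofReal_prod, mul_pow]
    have h1 := congrArg norm (hN ζ)
    rw [hA, hB, show (c * A) ^ 2 + (c * B) ^ 2 = c ^ 2 * ((A ^ 2 + B ^ 2 : ℝ) : ℂ) by
      push_cast; ring, norm_mul, norm_mul, Complex.norm_real, Real.norm_of_nonneg (by positivity),
      Complex.norm_ofNat] at h1
    rw [hM, hA, hB, show c * A * (c * B) = c ^ 2 * ((A * B : ℝ) : ℂ) by push_cast; ring, norm_mul,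
      Complex.norm_real, Real.norm_eq_abs]
    have h2 := mul_le_mul_of_nonneg_left key (norm_nonneg (c ^ 2))
    linear_combination h2 - 2 * q ^ k * h1

section Hankel
open Polynomial Matrix

lemma exists_hankel_functional {r : ℕ} {K : Matrix (Fin r) (Fin r) ℝ}
    (hHankel : ∀ i j k l : Fin r, (i : ℕ) + (j : ℕ) = (k : ℕ) + (l : ℕ) → K i j = K k l) :
    ∃ L : ℝ[X] →ₗ[ℝ] ℝ, ∀ p p' : ℝ[X], p.natDegree < r → p'.natDegree < r →
      (fun i : Fin r => p.coeff i) ⬝ᵥ K *ᵥ (fun i : Fin r => p'.coeff i) = L (p * p') := by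
  classical
  obtain ⟨μ, hμ⟩ : ∃ μ : ℕ → ℝ, ∀ i j : Fin r, K i j = μ (i + j) := by
    refine ⟨fun s => if h : ∃ x : Fin r × Fin r, (x.1 : ℕ) + x.2 = s then
      K h.choose.1 h.choose.2 else 0, fun i j => ?_⟩
    have h : ∃ x : Fin r × Fin r, (x.1 : ℕ) + x.2 = i + j := ⟨(i, j), rfl⟩
    simp only [dif_pos h]
    exact hHankel _ _ _ _ h.choose_spec.symm
  refine ⟨Polynomial.lsum fun n => μ n • LinearMap.id, fun p p' hp hp' => ?_⟩
  have hsum : ∀ f : ℝ[X], f.natDegree < r → f = ∑ i : Fin r, monomial i (f.coeff i) := by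
    intro f hf
    conv_lhs => rw [f.as_sum_range' r hf]
    exact (Fin.sum_univ_eq_sum_range (fun i => monomial i (f.coeff i)) r).symm
  conv_rhs => rw [hsum p hp, hsum p' hp']
  rw [Finset.sum_mul_sum]
  simp only [map_sum, monomial_mul_monomial, dotProduct, mulVec, Finset.mul_sum, hμ]
  refine Finset.sum_congr rfl fun i _ => Finset.sum_congr rfl fun j _ => ?_
  simp [Polynomial.lsum_apply, Polynomial.sum_monomial_index]
  ring

lemma sum_negRoot_pow_mul {n i j : ℕ} (hi : i < n) (hj : j < n) :
    ∑ l ∈ Finset.range n, negRoot n l ^ i * (negRoot n l)⁻¹ ^ j = if i = j then (n : ℂ) else 0 := by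
  split_ifs with h
  · subst h
    simp only [← mul_pow, mul_inv_cancel₀ (negRoot_ne_zero _ _)]
    simp
  · have hn : n ≠ 0 := by omega
    have hprim := Complex.isPrimitiveRoot_exp n hn
    set ω := Complex.exp (2 * π * Complex.I / n) with hω
    have hω0 : ω ≠ 0 := Complex.exp_ne_zero _
    have hx : ω ^ i * (ω ^ j)⁻¹ ≠ 1 := fun hx =>
      h (hprim.pow_inj hi hj ((mul_inv_eq_one₀ (pow_ne_zero _ hω0)).1 hx))
    have hxn : (ω ^ i * (ω ^ j)⁻¹) ^ n = 1 := by
      rw [mul_pow, inv_pow, ← pow_mul, ← pow_mul, mul_comm i, mul_comm j, pow_mul, pow_mul,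
        hprim.pow_eq_one, one_pow, one_pow, inv_one, mul_one]
    have hterm : ∀ l, negRoot n l ^ i * (negRoot n l)⁻¹ ^ j =
        (ω ^ i * (ω ^ j)⁻¹) ^ l * (negRoot n 0 ^ i * (negRoot n 0)⁻¹ ^ j) := by
      intro l
      rw [← exp_pow_mul_negRoot_zero n l, ← hω]
      simp only [mul_pow, mul_inv, inv_pow, ← pow_mul]
      rw [mul_comm l i, mul_comm l j]
      ring
    rw [Finset.sum_congr rfl fun l _ => hterm l, ← Finset.sum_mul, geom_sum_eq hx, hxn]
    simp

/-- Parseval's identity at the roots of `ω ^ n = -1`. -/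
lemma sum_norm_aeval_negRoot_sq {n : ℕ} {p : ℝ[X]} (hp : p.natDegree < n) :
    ∑ l ∈ Finset.range n, ‖aeval (negRoot n l) p‖ ^ 2 =
      n * ∑ i ∈ Finset.range n, p.coeff i ^ 2 := by
  have hterm : ∀ l, ((‖aeval (negRoot n l) p‖ ^ 2 : ℝ) : ℂ) =
      ∑ i ∈ Finset.range n, ∑ j ∈ Finset.range n,
        (p.coeff i * p.coeff j : ℂ) * (negRoot n l ^ i * (negRoot n l)⁻¹ ^ j) := by
    intro l
    rw [Complex.ofReal_pow, ← Complex.mul_conj', aeval_eq_sum_range' hp, map_sum,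
      Finset.sum_mul_sum]
    refine Finset.sum_congr rfl fun i _ => Finset.sum_congr rfl fun j _ => ?_
    rw [Complex.inv_eq_conj (norm_negRoot n l)]
    simp
    ring
  have hc : ((∑ l ∈ Finset.range n, ‖aeval (negRoot n l) p‖ ^ 2 : ℝ) : ℂ) =
      ((n * ∑ i ∈ Finset.range n, p.coeff i ^ 2 : ℝ) : ℂ) := by
    rw [Complex.ofReal_sum, Finset.sum_congr rfl fun l _ => hterm l, Finset.sum_comm]
    push_cast
    rw [Finset.mul_sum]
    refine Finset.sum_congr rfl fun i hi => ?_
    rw [Finset.sum_comm]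
    simp only [← Finset.mul_sum]
    rw [Finset.sum_congr rfl fun j hj => by
      rw [sum_negRoot_pow_mul (Finset.mem_range.1 hi) (Finset.mem_range.1 hj)]]
    simp [Finset.mem_range.1 hi]
    ring
  exact_mod_cast hc

lemma coeff_dotProduct_self {n r : ℕ} (hnr : n ≤ r) {p : ℝ[X]} (hp : p.natDegree < n) :
    (fun i : Fin r => p.coeff i) ⬝ᵥ (fun i : Fin r => p.coeff i) =
      ∑ i ∈ Finset.range n, p.coeff i ^ 2 := by
  simp only [dotProduct]
  rw [Fin.sum_univ_eq_sum_range (fun i => p.coeff i * p.coeff i)]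
  rw [← Finset.sum_subset (Finset.range_mono hnr) fun i _ hi => by
    rw [coeff_eq_zero_of_natDegree_lt (by simp at hi; omega), mul_zero]]
  exact Finset.sum_congr rfl fun i _ => (sq _).symm

lemma dotProduct_self_eq_sum {r : ℕ} {K : Matrix (Fin r) (Fin r) ℝ} (hK : K.IsHermitian)
    (x : Fin r → ℝ) : x ⬝ᵥ x = ∑ i, ((hK.eigenvectorBasis i).ofLp ⬝ᵥ x) ^ 2 := by
  have h := hK.eigenvectorBasis.sum_inner_mul_inner (WithLp.toLp 2 x) (WithLp.toLp 2 x)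
  simp only [EuclideanSpace.inner_eq_star_dotProduct, star_trivial] at h
  rw [← h]
  exact Finset.sum_congr rfl fun i _ => by rw [sq, dotProduct_comm x]

lemma dotProduct_mulVec_eq_sum {r : ℕ} {K : Matrix (Fin r) (Fin r) ℝ} (hK : K.IsHermitian)
    (x : Fin r → ℝ) :
    x ⬝ᵥ K *ᵥ x = ∑ i, hK.eigenvalues i * ((hK.eigenvectorBasis i).ofLp ⬝ᵥ x) ^ 2 := by
  have h := hK.eigenvectorBasis.sum_inner_mul_inner (WithLp.toLp 2 x) (WithLp.toLp 2 (K *ᵥ x))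
  simp only [EuclideanSpace.inner_eq_star_dotProduct, star_trivial] at h
  rw [dotProduct_comm x, ← h]
  refine Finset.sum_congr rfl fun i _ => ?_
  have hT : Kᵀ = K := by rw [← conjTranspose_eq_transpose_of_trivial]; exact hK
  rw [dotProduct_comm (K *ᵥ x), dotProduct_mulVec, ← mulVec_transpose, hT,
    hK.mulVec_eigenvectorBasis, smul_dotProduct, smul_eq_mul]
  ring

lemma exists_mul_orthogonal {r d c : ℕ} (hdc : c < d) (e : Fin c → Fin r → ℝ) (N : ℝ[X]) :
    ∃ h : ℝ[X], h ≠ 0 ∧ h.degree < d ∧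
      ∀ j, e j ⬝ᵥ (fun i : Fin r => (h * N).coeff i) = 0 := by
  let φ : (Fin d → ℝ) →ₗ[ℝ] (Fin c → ℝ) := LinearMap.pi fun j => ∑ i : Fin r,
    e j i • (lcoeff ℝ (i : ℕ) ∘ₗ LinearMap.mulRight ℝ N ∘ₗ (degreeLT ℝ d).subtype ∘ₗ
      (degreeLTEquiv ℝ d).symm.toLinearMap)
  have hker := LinearMap.ker_ne_bot_of_finrank_lt (f := φ) (by simpa using hdc)
  obtain ⟨x, hx, hx0⟩ := Submodule.exists_mem_ne_zero_of_ne_bot hker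
  refine ⟨(degreeLTEquiv ℝ d).symm x, ?_, mem_degreeLT.1 ((degreeLTEquiv ℝ d).symm x).2,
    fun j => ?_⟩
  · simpa using hx0
  · have := congrFun (LinearMap.mem_ker.1 hx) j
    simpa [φ, dotProduct] using this

lemma eigenvalue_le_of_filter {r m k : ℕ} (hmr : 2 * m ≤ r) (hrm : r ≤ 2 * m + 1)
    {K : Matrix (Fin r) (Fin r) ℝ} (hK : K.PosSemidef)
    (hHankel : ∀ i j k l : Fin r, (i : ℕ) + (j : ℕ) = (k : ℕ) + (l : ℕ) → K i j = K k l)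
    {lam : Fin r → ℝ} (hanti : Antitone lam) {σ : Equiv.Perm (Fin r)}
    (hσ : ∀ i, lam i = hK.isHermitian.eigenvalues (σ i)) {s : ℝ} {u v : ℝ[X]}
    (hu : u.natDegree ≤ k) (hv : v.natDegree ≤ k) (huv : u ^ 2 - v ^ 2 ≠ 0)
    (hle : ∀ l < 2 * m, ‖aeval (negRoot (2 * m) l) (u ^ 2 + v ^ 2)‖ ≤
      4 * s * ‖aeval (negRoot (2 * m) l) (u ^ 2 - v ^ 2)‖)
    (hk : 2 * (k + 1) < r) :
    lam ⟨2 * (k + 1), hk⟩ ≤ 16 * s ^ 2 * lam ⟨0, by omega⟩ := by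
  obtain ⟨h, h0, hdeg, horth⟩ := exists_mul_orthogonal (r := r) (d := 2 * m - 2 * k)
    (c := r - (2 * (k + 1) + 1)) (by omega)
    (fun j => (hK.isHermitian.eigenvectorBasis (σ ⟨2 * (k + 1) + 1 + j, by omega⟩)).ofLp)
    (u ^ 2 - v ^ 2)
  have hdeg' : h.natDegree < 2 * m - 2 * k := (natDegree_lt_iff_degree_lt h0).2 hdeg
  have hu2 : (u ^ 2).natDegree ≤ 2 * k := natDegree_pow_le_of_le 2 hu
  have hv2 : (v ^ 2).natDegree ≤ 2 * k := natDegree_pow_le_of_le 2 hv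
  have hmul : ∀ f : ℝ[X], f.natDegree ≤ 2 * k → (h * f).natDegree < 2 * m := fun f hf =>
    (natDegree_mul_le_of_le le_rfl hf).trans_lt (by omega)
  set p := h * (u ^ 2 - v ^ 2) with hp
  set p' := h * (u ^ 2 + v ^ 2) with hp'
  set f := h * (C 2 * (u * v)) with hf
  have hpd : p.natDegree < 2 * m :=
    hmul _ ((natDegree_sub_le_of_le hu2 hv2).trans (max_self _).le)
  have hpd' : p'.natDegree < 2 * m := hmul _ (natDegree_add_le_of_degree_le hu2 hv2)
  have hfd : f.natDegree < 2 * m := hmul _ ((natDegree_C_mul_le _ _).trans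
    ((natDegree_mul_le_of_le hu hv).trans (by omega)))
  set x : Fin r → ℝ := fun i => p.coeff i with hx
  set y : Fin r → ℝ := fun i => p'.coeff i with hy
  have hKxy : x ⬝ᵥ K *ᵥ x ≤ y ⬝ᵥ K *ᵥ y := by
    obtain ⟨L, hL⟩ := exists_hankel_functional hHankel
    rw [hx, hy, hL p p (by omega) (by omega), hL p' p' (by omega) (by omega)]
    have h1 := hK.dotProduct_mulVec_nonneg (fun i : Fin r => f.coeff i)
    rw [star_trivial, hL f f (by omega) (by omega)] at h1
    have h2 : p' * p' = p * p + f * f := by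
      rw [hp, hp', hf, show (C 2 : ℝ[X]) = 2 from rfl]; ring
    rw [h2, map_add]
    linarith
  have hm : 0 < m := by omega
  have hxy : y ⬝ᵥ y ≤ 16 * s ^ 2 * (x ⬝ᵥ x) := by
    rw [hx, hy, coeff_dotProduct_self hmr hpd, coeff_dotProduct_self hmr hpd']
    have hm' : (0 : ℝ) < (2 * m : ℕ) := by exact_mod_cast (by omega : 0 < 2 * m)
    refine le_of_mul_le_mul_left ?_ hm'
    rw [mul_left_comm, ← sum_norm_aeval_negRoot_sq hpd, ← sum_norm_aeval_negRoot_sq hpd',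
      Finset.mul_sum]
    refine Finset.sum_le_sum fun l hl => ?_
    have h1 := hle l (Finset.mem_range.1 hl)
    rw [hp, hp', map_mul, map_mul, norm_mul, norm_mul]
    have h2 := pow_le_pow_left₀ (norm_nonneg _) h1 2
    have h3 := mul_le_mul_of_nonneg_left h2 (sq_nonneg ‖aeval (negRoot (2 * m) l) h‖)
    linarith
  have hx0 : 0 < x ⬝ᵥ x := by
    refine lt_of_le_of_ne (Finset.sum_nonneg fun i _ => mul_self_nonneg _) fun h => ?_
    have h1 := congrFun (dotProduct_self_eq_zero.1 h.symm) ⟨p.natDegree, by omega⟩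
    exact mul_ne_zero h0 huv (leadingCoeff_eq_zero.1 h1)
  set a : Fin r → (Fin r → ℝ) → ℝ :=
    fun i z => ((hK.isHermitian.eigenvectorBasis (σ i)).ofLp ⬝ᵥ z) ^ 2 with ha
  have ha0 : ∀ i z, 0 ≤ a i z := fun i z => sq_nonneg _
  have hnorm : ∀ z, z ⬝ᵥ z = ∑ i, a i z := fun z => by
    rw [dotProduct_self_eq_sum hK.isHermitian, ← Equiv.sum_comp σ]
  have hquad : ∀ z, z ⬝ᵥ K *ᵥ z = ∑ i, lam i * a i z := fun z => by
    rw [dotProduct_mulVec_eq_sum hK.isHermitian, ← Equiv.sum_comp σ]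
    simp only [hσ, ha]
  have hlow : lam ⟨2 * (k + 1), hk⟩ * (x ⬝ᵥ x) ≤ x ⬝ᵥ K *ᵥ x := by
    rw [hnorm, hquad, Finset.mul_sum]
    refine Finset.sum_le_sum fun i _ => ?_
    rcases le_or_gt (i : ℕ) (2 * (k + 1)) with hi | hi
    · exact mul_le_mul_of_nonneg_right (hanti hi) (ha0 _ _)
    · have h1 := horth ⟨i - (2 * (k + 1) + 1), by omega⟩
      have h2 : (⟨2 * (k + 1) + 1 + (i - (2 * (k + 1) + 1)), by omega⟩ : Fin r) = i :=
        Fin.ext (by simp only []; omega)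
      simp only [h2] at h1
      have h3 : a i x = 0 := by simp only [ha, h1]; norm_num
      rw [h3, mul_zero, mul_zero]
  have hupp : y ⬝ᵥ K *ᵥ y ≤ lam ⟨0, by omega⟩ * (y ⬝ᵥ y) := by
    rw [hnorm, hquad, Finset.mul_sum]
    exact Finset.sum_le_sum fun i _ =>
      mul_le_mul_of_nonneg_right (hanti (Nat.zero_le _)) (ha0 _ _)
  have hl0 : 0 ≤ lam ⟨0, by omega⟩ := by
    rw [hσ]; exact hK.eigenvalues_nonneg _
  refine le_of_mul_le_mul_right ?_ hx0
  have := mul_le_mul_of_nonneg_left hxy hl0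
  linarith

end Hankel

end HankelDecay

/-- Exponential decay of the eigenvalues (listed decreasingly) of a real
positive semidefinite Hankel matrix. -/
theorem stmt2 {r : ℕ} (hr : 2 ≤ r)
    (K : Matrix (Fin r) (Fin r) ℝ)
    (hK : K.PosSemidef)
    (hHankel : ∀ i j k l : Fin r, (i : ℕ) + (j : ℕ) = (k : ℕ) + (l : ℕ) → K i j = K k l)
    (lam : Fin r → ℝ) (hanti : Antitone lam)
    (hperm : ∃ σ : Equiv.Perm (Fin r), ∀ i, lam i = hK.isHermitian.eigenvalues (σ i)) :
    ∀ k : ℕ, ∀ _h2k : 2 * k + 1 ≤ r,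
      lam ⟨2 * k, by omega⟩ ≤
        16 * (Real.exp (π ^ 2 / (4 * Real.log (8 * ((r / 2 : ℕ) : ℝ) / π)))) ^
            (2 - 2 * (k : ℤ)) *
          lam ⟨0, by omega⟩ := by
  intro k h2k
  obtain ⟨σ, hσ⟩ := hperm
  have hl0 : 0 ≤ lam ⟨0, by omega⟩ := by
    rw [hσ]; exact hK.eigenvalues_nonneg _
  have hle : lam ⟨2 * k, by omega⟩ ≤ lam ⟨0, by omega⟩ := hanti (Nat.zero_le _)
  have hm : 0 < r / 2 := by omega
  have hm' : (1 : ℝ) ≤ (r / 2 : ℕ) := by exact_mod_cast hm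
  have hL : 0 < Real.log (8 * ((r / 2 : ℕ) : ℝ) / π) := by
    refine Real.log_pos ?_
    rw [lt_div_iff₀ Real.pi_pos]
    linarith [Real.pi_le_four]
  set ρ := Real.exp (π ^ 2 / (4 * Real.log (8 * ((r / 2 : ℕ) : ℝ) / π))) with hρ
  have hρ1 : 1 ≤ ρ := Real.one_le_exp (by positivity)
  have htriv : 1 ≤ 16 * ρ ^ (2 - 2 * (k : ℤ)) → lam ⟨2 * k, by omega⟩ ≤
      16 * ρ ^ (2 - 2 * (k : ℤ)) * lam ⟨0, by omega⟩ := fun h =>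
    hle.trans (le_mul_of_one_le_left hl0 h)
  rcases k with _ | k
  · refine htriv ?_
    have := one_le_zpow₀ hρ1 (by norm_num : (0 : ℤ) ≤ 2 - 2 * ((0 : ℕ) : ℤ))
    linarith
  have hq : ρ⁻¹ = Real.exp (-(π ^ 2 / (4 * Real.log (8 * ((r / 2 : ℕ) : ℝ) / π)))) := by
    rw [Real.exp_neg]
  have hpow : ρ ^ (2 - 2 * ((k + 1 : ℕ) : ℤ)) = (ρ⁻¹ ^ k) ^ 2 := by
    rw [← pow_mul, inv_pow, ← zpow_natCast, ← zpow_neg]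
    congr 1
    push_cast
    ring
  rcases lt_or_ge (1 / 4) (ρ⁻¹ ^ k) with hs | hs
  · refine htriv ?_
    rw [hpow]
    nlinarith
  have hk : 0 < k := by
    rcases Nat.eq_zero_or_pos k with rfl | hk
    · norm_num at hs
    · exact hk
  obtain ⟨u, v, hu, hv, huv, huv_le⟩ := HankelDecay.exists_filter hm hk hq hs
  rw [hpow]
  exact HankelDecay.eigenvalue_le_of_filter (by omega) (by omega) hK hHankel hanti hσ hu hv huv
    huv_le (by omega)
end

section
/- Let W be a real vector space, let ℓ ≥ 2, let w_1, …, w_ℓ ∈ W, let μ_1, …, μ_ℓ be positive reals with μ_1 = μ_2 and μ_2 > μ_3 > … > μ_ℓ > 0, and let c_1, …, c_ℓ ∈ ℝ with c_i ≠ 0 for all 2 ≤ i ≤ ℓ. Define v_j = Σ_{i=1}^ℓ c_i μ_i^j w_i for j = 1, …, ℓ − 1. Then for any reals α_1, …, α_ℓ satisfying c_2 α_1 = c_1 α_2, the vector Σ_{i=1}^ℓ α_i w_i lies in the span of {v_1, …, v_{ℓ−1}}. -/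
open Polynomial in
/-- Weighting `w i` by `c i * μ i * p (μ i)`, where `p` has degree less than `n`, gives a combination
of the vectors `∑ i, (c i * μ i ^ (j + 1)) • w i` with `j < n`. -/
lemma sum_mul_eval_smul_mem_span {K W ι : Type*} [Field K] [AddCommGroup W] [Module K W]
    [Fintype ι] {n : ℕ} (w : ι → W) (μ c : ι → K) (p : K[X]) (hp : p.degree < n) :
    ∑ i, (c i * μ i * p.eval (μ i)) • w i ∈
      Submodule.span K (Set.range fun j : Fin n => ∑ i, (c i * μ i ^ ((j : ℕ) + 1)) • w i) := by
  have heval (x : K) : p.eval x = ∑ j : Fin n, p.coeff j * x ^ (j : ℕ) := by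
    rw [Polynomial.eval_eq_sum, ← Polynomial.sum_fin (fun j a => a * x ^ j) (by simp) hp]
  have hsum : ∑ i, (c i * μ i * p.eval (μ i)) • w i =
      ∑ j : Fin n, p.coeff j • ∑ i, (c i * μ i ^ ((j : ℕ) + 1)) • w i := by
    simp_rw [heval, Finset.mul_sum, Finset.sum_smul, Finset.smul_sum, smul_smul]
    rw [Finset.sum_comm]
    refine Finset.sum_congr rfl fun j _ => Finset.sum_congr rfl fun i _ => ?_
    congr 1
    ring
  rw [hsum]
  exact Submodule.sum_mem _ fun j _ =>
    Submodule.smul_mem _ _ (Submodule.subset_span (Set.mem_range_self j))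


/-- Any combination `Σ α_i w_i` whose first two coefficients satisfy
`c_2 α_1 = c_1 α_2` lies in the span of the snapshot vectors
`v_j = Σ c_i μ_i^j w_i`, `j = 1, …, ℓ − 1`. -/
theorem stmt9 {W : Type*} [AddCommGroup W] [Module ℝ W]
    {ℓ : ℕ} (hℓ : 2 ≤ ℓ)
    (w : Fin ℓ → W) (μ c : Fin ℓ → ℝ)
    (hμpos : ∀ i, 0 < μ i)
    (hμ12 : μ ⟨0, by omega⟩ = μ ⟨1, by omega⟩)
    (hμdec : ∀ i j : Fin ℓ, 1 ≤ (i : ℕ) → i < j → μ j < μ i)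
    (hc : ∀ i : Fin ℓ, 1 ≤ (i : ℕ) → c i ≠ 0)
    (v : Fin (ℓ - 1) → W)
    (hv : ∀ j : Fin (ℓ - 1), v j = ∑ i, (c i * μ i ^ ((j : ℕ) + 1)) • w i)
    (α : Fin ℓ → ℝ)
    (hα : c ⟨1, by omega⟩ * α ⟨0, by omega⟩ = c ⟨0, by omega⟩ * α ⟨1, by omega⟩) :
    (∑ i, α i • w i) ∈ Submodule.span ℝ (Set.range v) := by
  set i₀ : Fin ℓ := ⟨0, by omega⟩ with hi₀
  set i₁ : Fin ℓ := ⟨1, by omega⟩ with hi₁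
  have hpos {i : Fin ℓ} (hi : i ≠ i₀) : 1 ≤ (i : ℕ) :=
    Nat.one_le_iff_ne_zero.mpr fun h => hi (Fin.ext h)
  have hne : i₁ ≠ i₀ := by simp [hi₀, hi₁]
  have hinj : Set.InjOn μ (Finset.univ.erase i₀ : Finset (Fin ℓ)) := by
    intro i hi j hj hij
    have hi' : i ≠ i₀ := by simpa using hi
    have hj' : j ≠ i₀ := by simpa using hj
    rcases lt_trichotomy i j with h | h | h
    · exact absurd hij (hμdec i j (hpos hi') h).ne'
    · exact h
    · exact absurd hij (hμdec j i (hpos hj') h).ne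
  set p := Lagrange.interpolate (Finset.univ.erase i₀) μ (fun i => α i / (c i * μ i))
  have hdeg : p.degree < ((ℓ - 1 : ℕ) : WithBot ℕ) := by
    have hcard : (Finset.univ.erase i₀).card = ℓ - 1 := by simp
    exact hcard ▸ Lagrange.degree_interpolate_lt (fun i => α i / (c i * μ i)) hinj
  have heval {i : Fin ℓ} (hi : i ≠ i₀) : p.eval (μ i) = α i / (c i * μ i) :=
    Lagrange.eval_interpolate_at_node _ hinj (by simpa using hi)
  have hα' (i : Fin ℓ) : c i * μ i * p.eval (μ i) = α i := by
    by_cases hi : i = i₀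
    · have hc₁ := hc i₁ le_rfl
      have hμ₁ := (hμpos i₁).ne'
      rw [hi, hμ12, heval hne]
      field_simp
      linarith
    · have hci := hc i (hpos hi)
      have hμi := (hμpos i).ne'
      rw [heval hi]
      field_simp
  have key := sum_mul_eval_smul_mem_span w μ c p hdeg
  simp_rw [hα', ← hv] at key
  exact key
end

section
/- Let W be a real vector space, let ℓ ≥ 2, let w_1, …, w_ℓ ∈ W be linearly independent, let μ_1, …, μ_ℓ be positive reals with μ_1 = μ_2 and μ_2 > μ_3 > … > μ_ℓ > 0, and let c_1, …, c_ℓ ∈ ℝ with c_i ≠ 0 for all 2 ≤ i ≤ ℓ. Define v_j = Σ_{i=1}^ℓ c_i μ_i^j w_i for j = 1, …, ℓ. Then v_1, …, v_{ℓ−1} are linearly independent and v_ℓ lies in the span of {v_1, …, v_{ℓ−1}}; in particular, ℓ − 1 is the largest number m such that v_1, …, v_m are linearly independent. -/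
/-- More vectors than the size of a family spanning them cannot be linearly independent. -/
theorem not_linearIndependent_of_mem_span_range {K V ι κ : Type*} [Field K] [AddCommGroup V]
    [Module K V] [Fintype ι] [Fintype κ] (u : κ → V) (v : ι → V)
    (hcard : Fintype.card κ < Fintype.card ι)
    (h : ∀ i, v i ∈ Submodule.span K (Set.range u)) : ¬ LinearIndependent K v := by
  intro hv
  have h1 := finrank_span_eq_card hv
  have hle : Submodule.span K (Set.range v) ≤ Submodule.span K (Set.range u) :=
    Submodule.span_le.2 (Set.range_subset_iff.2 h)
  have : FiniteDimensional K (Submodule.span K (Set.range u)) :=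
    FiniteDimensional.span_of_finite K (Set.finite_range u)
  have h2 := Submodule.finrank_mono hle
  have h3 : Module.finrank K (Submodule.span K (Set.range u)) ≤ Fintype.card κ :=
    finrank_range_le_card u
  omega


/-- With linearly independent `w_i` and `μ_1 = μ_2 > μ_3 > … > μ_ℓ > 0`,
the vectors `v_j = Σ c_i μ_i^j w_i` satisfy: `v_1, …, v_{ℓ−1}` are linearly
independent, `v_ℓ` lies in their span, and `ℓ − 1` is the largest number of
initial `v_j`'s that are linearly independent. -/
theorem stmt10 {W : Type*} [AddCommGroup W] [Module ℝ W]
    {ℓ : ℕ} (hℓ : 2 ≤ ℓ)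
    (w : Fin ℓ → W) (hw : LinearIndependent ℝ w)
    (μ c : Fin ℓ → ℝ)
    (hμpos : ∀ i, 0 < μ i)
    (hμ12 : μ ⟨0, by omega⟩ = μ ⟨1, by omega⟩)
    (hμdec : ∀ i j : Fin ℓ, 1 ≤ (i : ℕ) → i < j → μ j < μ i)
    (hc : ∀ i : Fin ℓ, 1 ≤ (i : ℕ) → c i ≠ 0)
    (v : Fin ℓ → W)
    (hv : ∀ j : Fin ℓ, v j = ∑ i, (c i * μ i ^ ((j : ℕ) + 1)) • w i) :
    LinearIndependent ℝ (fun j : Fin (ℓ - 1) => v (Fin.castLE (by omega) j)) ∧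
    v ⟨ℓ - 1, by omega⟩ ∈
      Submodule.span ℝ (Set.range fun j : Fin (ℓ - 1) => v (Fin.castLE (by omega) j)) ∧
    ∀ m : ℕ, ∀ hm : m ≤ ℓ,
      LinearIndependent ℝ (fun j : Fin m => v (Fin.castLE hm j)) → m ≤ ℓ - 1 := by
  obtain ⟨n, rfl⟩ : ∃ n, ℓ = n + 2 := ⟨ℓ - 2, by omega⟩
  change LinearIndependent ℝ (fun j : Fin (n + 1) => v j.castSucc) ∧
    v (Fin.last (n + 1)) ∈
      Submodule.span ℝ (Set.range fun j : Fin (n + 1) => v j.castSucc) ∧ _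
  replace hμ12 : μ 0 = μ (Fin.succ 0) := hμ12
  have hinj : Function.Injective fun k : Fin (n + 1) => μ k.succ := by
    refine StrictAnti.injective fun a b hab => hμdec _ _ (by simp) ?_
    simpa using hab
  have hindep : LinearIndependent ℝ (fun j : Fin (n + 1) => v j.castSucc) := by
    rw [Fintype.linearIndependent_iff]
    intro g hg
    have hsum : ∑ i, (∑ j : Fin (n + 1), g j * (c i * μ i ^ ((j : ℕ) + 1))) • w i = 0 := by
      rw [← hg]
      simp only [hv, Finset.smul_sum, Finset.sum_smul, smul_smul, Fin.val_castSucc]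
      exact Finset.sum_comm
    have hcoeff := Fintype.linearIndependent_iff.1 hw _ hsum
    refine congrFun (Matrix.eq_zero_of_forall_index_sum_mul_pow_eq_zero hinj fun k => ?_)
    have hne : c k.succ * μ k.succ ≠ 0 := mul_ne_zero (hc _ (by simp)) (hμpos _).ne'
    refine (mul_eq_zero.1 ?_).resolve_left hne
    rw [← hcoeff k.succ, Finset.mul_sum]
    exact Finset.sum_congr rfl fun j _ => by ring
  have hdep : ¬ LinearIndependent ℝ v := by
    refine not_linearIndependent_of_mem_span_range
      (Fin.cons (c 0 • w 0 + c (Fin.succ 0) • w (Fin.succ 0))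
        fun k : Fin n => w k.succ.succ) v (by simp) fun j => ?_
    rw [hv, Fin.sum_univ_succ, Fin.sum_univ_succ, ← add_assoc, hμ12, mul_comm (c 0),
      mul_comm (c (Fin.succ 0)), mul_smul, mul_smul, ← smul_add]
    refine add_mem (Submodule.smul_mem _ _ (Submodule.subset_span ⟨0, rfl⟩))
      (sum_mem fun k _ => Submodule.smul_mem _ _ (Submodule.subset_span ⟨k.succ, rfl⟩))
  refine ⟨hindep, ?_, fun m hm hli => ?_⟩
  · by_contra hmem
    refine hdep ?_
    rw [← Fin.snoc_init_self v]
    exact linearIndependent_finSnoc.2 ⟨hindep, hmem⟩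
  · by_contra hlt
    obtain rfl : m = n + 2 := by omega
    exact hdep hli
end
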